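/- arXiv:0906.3376 — 6 statements merged into one kernel-verified Lean document; each statement's English description precedes it below -/
import Mathlib

section
/- Let N₁, N₂ : V → V be ℝ-linear endomorphisms such that Nᵢ(V) ⊆ H' for i = 1, 2 and such that N₁ and N₂ agree on H'. Write N' : H' → H' for the common restriction. Then N₁ ∘ N₂ = N₂ ∘ N₁ if and only if N₁(e) − N₂(e) ∈ Ker(N'). -/
/-- let `V` be a real vector space which is the internal direct sum of a
subspace `H'` and the line `ℝ·e`, and let `N₁, N₂ : V → V` be ℝ-linear maps with
`Nᵢ(V) ⊆ H'` agreeing on `H'` (their common restriction being `N' : H' → H'`).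
Then `N₁ ∘ N₂ = N₂ ∘ N₁` iff `N₁(e) - N₂(e) ∈ Ker(N')`.
Here `N'` is realized as the domain restriction of `N₁` (equivalently of `N₂`) to `H'`,
and `N₁ e - N₂ e` is an element of `H'` since both `N₁ e` and `N₂ e` lie in `H'`. -/
theorem stmt0 (V : Type*) [AddCommGroup V] [Module ℝ V]
    (H' : Submodule ℝ V) (e : V)
    -- `ℝ·e` is a line
    (he : e ≠ 0)
    -- `V` is the internal direct sum of `H'` and `ℝ·e`
    (hcompl : IsCompl H' (Submodule.span ℝ {e}))
    (N₁ N₂ : V →ₗ[ℝ] V)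
    -- `Nᵢ(V) ⊆ H'`
    (h₁ : ∀ v : V, N₁ v ∈ H') (h₂ : ∀ v : V, N₂ v ∈ H')
    -- `N₁` and `N₂` agree on `H'`
    (hagree : ∀ v ∈ H', N₁ v = N₂ v) :
    N₁ ∘ₗ N₂ = N₂ ∘ₗ N₁ ↔
      (⟨N₁ e - N₂ e, sub_mem (h₁ e) (h₂ e)⟩ : H') ∈
        LinearMap.ker (N₁.domRestrict H') := by
  rw [LinearMap.mem_ker, LinearMap.domRestrict_apply, map_sub, sub_eq_zero,
    hagree _ (h₁ e)]
  constructor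
  · intro h
    exact (LinearMap.congr_fun h e).symm
  · intro h
    refine LinearMap.ext fun v => ?_
    have hv : v ∈ H' ⊔ Submodule.span ℝ {e} := hcompl.sup_eq_top ▸ Submodule.mem_top
    obtain ⟨w, hw, y, hy, rfl⟩ := Submodule.mem_sup.mp hv
    obtain ⟨c, rfl⟩ := Submodule.mem_span_singleton.mp hy
    simp only [LinearMap.comp_apply, map_add, map_smul]
    rw [← h, ← hagree w hw, hagree _ (h₁ w)]
end

section
/- Let N : H → H be a linear map such that N(H) ⊆ H' and such that the restriction of N to H' equals N'. Then a relative monodromy filtration M(N,W) exists if and only if N(e) ∈ N'(H') + W'_{−2}. -/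
/-- `M` is a relative monodromy filtration `M(N, W)`.  The bijectivity of the map
`gr^M_{j+l}(gr^W_j) → gr^M_{j-l}(gr^W_j)` induced by `N^l` is encoded, without forming
quotients, by two lattice-theoretic conditions: surjectivity is
`M_{j-l} ∩ W_j ⊆ N^l(M_{j+l} ∩ W_j) + (M_{j-l-1} ∩ W_j) + W_{j-1}` and injectivity is
`(M_{j+l} ∩ W_j) ∩ (N^l)⁻¹((M_{j-l-1} ∩ W_j) + W_{j-1}) ⊆ (M_{j+l-1} ∩ W_j) + W_{j-1}`. -/
def IsRelMonodromyFil {K V : Type*} [Field K] [AddCommGroup V] [Module K V]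
    (N : V →ₗ[K] V) (W M : ℤ → Submodule K V) : Prop :=
  Monotone M ∧
  (∃ j₀ : ℤ, ∀ j ≤ j₀, M j = ⊥) ∧
  (∃ j₁ : ℤ, ∀ j, j₁ ≤ j → M j = ⊤) ∧
  (∀ j : ℤ, (M j).map N ≤ M (j - 2)) ∧
  ∀ (j : ℤ) (l : ℕ),
    (M (j - l) ⊓ W j ≤
      Submodule.map (N ^ l : V →ₗ[K] V) (M (j + l) ⊓ W j) ⊔ (M (j - l - 1) ⊓ W j) ⊔ W (j - 1)) ∧
    ((M (j + l) ⊓ W j) ⊓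
        Submodule.comap (N ^ l : V →ₗ[K] V) ((M (j - l - 1) ⊓ W j) ⊔ W (j - 1)) ≤
      (M (j + l - 1) ⊓ W j) ⊔ W (j - 1))

/-- `W'` is the monodromy weight filtration of the nilpotent endomorphism `N`, centered
at `k`: increasing, exhaustive, `N W'_j ⊆ W'_{j-2}`, and `N^l` induces a bijection
`W'_{k+l}/W'_{k+l-1} → W'_{k-l}/W'_{k-l-1}` for every `l ≥ 0` (bijectivity of the induced
map being encoded by: surjectivity `W'_{k-l} ⊆ N^l(W'_{k+l}) + W'_{k-l-1}` and injectivity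
`W'_{k+l} ∩ (N^l)⁻¹(W'_{k-l-1}) ⊆ W'_{k+l-1}`). -/
def IsWeightMonodromyFil {K V : Type*} [Field K] [AddCommGroup V] [Module K V]
    (N : V →ₗ[K] V) (k : ℤ) (W' : ℤ → Submodule K V) : Prop :=
  Monotone W' ∧
  (∃ j₀ : ℤ, ∀ j ≤ j₀, W' j = ⊥) ∧
  (∃ j₁ : ℤ, ∀ j, j₁ ≤ j → W' j = ⊤) ∧
  (∀ j : ℤ, (W' j).map N ≤ W' (j - 2)) ∧
  ∀ l : ℕ,
    (W' (k - l) ≤ Submodule.map (N ^ l : V →ₗ[K] V) (W' (k + l)) ⊔ W' (k - l - 1)) ∧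
    (W' (k + l) ⊓ Submodule.comap (N ^ l : V →ₗ[K] V) (W' (k - l - 1)) ≤ W' (k + l - 1))

namespace IsWeightMonodromyFil

variable {K V : Type*} [Field K] [AddCommGroup V] [Module K V] {N : V →ₗ[K] V} {k : ℤ}
  {W W₁ W₂ : ℤ → Submodule K V}

theorem apply_mem (h : IsWeightMonodromyFil N k W) {i j : ℤ} (hij : i - 2 ≤ j) {x : V}
    (hx : x ∈ W i) : N x ∈ W j :=
  h.1 hij (h.2.2.2.1 i ⟨x, hx, rfl⟩)

theorem pow_apply_mem (h : IsWeightMonodromyFil N k W) (l : ℕ) {i j : ℤ} (hij : i - 2 * l ≤ j)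
    {x : V} (hx : x ∈ W i) : (N ^ l) x ∈ W j := by
  induction l generalizing j with
  | zero => exact h.1 (by simpa using hij) hx
  | succ l ih =>
    rw [pow_succ', Module.End.mul_apply]
    exact h.apply_mem (by push_cast at hij; lia) (ih le_rfl)

theorem le_map_pow (h : IsWeightMonodromyFil N k W) (l : ℕ) :
    W (k - l) ≤ (W (k + l)).map (N ^ l) := by
  obtain ⟨j₀, hj₀⟩ := h.2.1
  have key : ∀ n l : ℕ, k - l - n ≤ j₀ → W (k - l) ≤ (W (k + l)).map (N ^ l) := by
    intro n
    induction n with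
    | zero =>
      intro l hl
      simp [hj₀ (k - l) (by simpa using hl)]
    | succ n ih =>
      refine fun l hl => (h.2.2.2.2 l).1.trans (sup_le le_rfl fun x hx => ?_)
      obtain ⟨y, hy, rfl⟩ := ih (l + 1) (by push_cast at hl ⊢; lia) (h.1 (by push_cast; lia) hx)
      refine ⟨N y, h.apply_mem (by push_cast; lia) hy, ?_⟩
      rw [pow_succ, Module.End.mul_apply]
  exact key (k - l - j₀).toNat l (by lia)

theorem ker_pow_le (h : IsWeightMonodromyFil N k W) (l : ℕ) :
    LinearMap.ker (N ^ (l + 1)) ≤ W (k + l) := by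
  obtain ⟨j₁, hj₁⟩ := h.2.2.1
  intro x hx
  have key : ∀ n : ℕ, x ∈ W (k + l + n) → x ∈ W (k + l) := by
    intro n
    induction n with
    | zero => simp
    | succ n ih =>
      refine fun hn => ih (h.1 ?_ ((h.2.2.2.2 (l + 1 + n)).2 ⟨?_, ?_⟩))
      · push_cast; lia
      · exact h.1 (by push_cast; lia) hn
      · rw [SetLike.mem_coe, Submodule.mem_comap, add_comm, pow_add, Module.End.mul_apply,
          LinearMap.mem_ker.1 hx, map_zero]
        exact zero_mem _
  exact key (j₁ - (k + l)).toNat (by rw [hj₁ _ (by lia)]; trivial)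

theorem le_of_nonneg (h₁ : IsWeightMonodromyFil N k W₁) (h₂ : IsWeightMonodromyFil N k W₂)
    (l : ℕ) : W₁ (k + l) ≤ W₂ (k + l) := by
  obtain ⟨j₁, hj₁⟩ := h₂.2.2.1
  have key : ∀ n l : ℕ, j₁ ≤ k + l + n → W₁ (k + l) ≤ W₂ (k + l) := by
    intro n
    induction n with
    | zero =>
      intro l hl
      simp [hj₁ (k + l) (by simpa using hl)]
    | succ n ih =>
      intro l hl x hx
      obtain ⟨y, hy, hyx⟩ := h₁.le_map_pow (l + 2)
        (h₁.pow_apply_mem (l + 1) (j := k - (l + 2 : ℕ)) (by push_cast; lia) hx)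
      have hker : x - N y ∈ LinearMap.ker (N ^ (l + 1)) := by
        rw [LinearMap.mem_ker, map_sub, ← hyx, ← Module.End.mul_apply, ← pow_succ, sub_self]
      have hNy : N y ∈ W₂ (k + l) :=
        h₂.apply_mem (by push_cast; lia) (ih (l + 2) (by push_cast at hl ⊢; lia) hy)
      simpa using add_mem (h₂.ker_pow_le l hker) hNy
  exact key (j₁ - (k + l)).toNat l (by lia)

theorem le (h₁ : IsWeightMonodromyFil N k W₁) (h₂ : IsWeightMonodromyFil N k W₂) :
    W₁ ≤ W₂ := by
  intro j
  obtain hj | hj := le_total k j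
  · obtain ⟨l, rfl⟩ := Int.exists_add_of_le hj
    exact h₁.le_of_nonneg h₂ l
  · obtain ⟨l, rfl⟩ : ∃ l : ℕ, j = k - l := ⟨(k - j).toNat, by lia⟩
    intro x hx
    obtain ⟨y, hy, rfl⟩ := h₁.le_map_pow l hx
    exact h₂.pow_apply_mem l (by lia) (h₁.le_of_nonneg h₂ l hy)

/-- The monodromy weight filtration is unique. -/
theorem unique (h₁ : IsWeightMonodromyFil N k W₁) (h₂ : IsWeightMonodromyFil N k W₂) :
    W₁ = W₂ :=
  le_antisymm (h₁.le h₂) (h₂.le h₁)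

end IsWeightMonodromyFil

section OneDimensionalExtension

variable {K V : Type*} [Field K] [AddCommGroup V] [Module K V] {N' : V →ₗ[K] V}
  {N : (V × K) →ₗ[K] (V × K)} {k : ℤ}

/-- The filtration of `V × K` with graded pieces `V` in degree `k` and `K` in degree `0`. -/
def twoStepFil (K V : Type*) [Field K] [AddCommGroup V] [Module K V] (k : ℤ) (j : ℤ) :
    Submodule K (V × K) :=
  if 0 ≤ j then ⊤ else if k ≤ j then LinearMap.ker (LinearMap.snd K V K) else ⊥

theorem twoStepFil_of_nonneg {j : ℤ} (hj : 0 ≤ j) : twoStepFil K V k j = ⊤ := if_pos hj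

theorem twoStepFil_of_neg {j : ℤ} (hj : j < 0) (hkj : k ≤ j) :
    twoStepFil K V k j = LinearMap.ker (LinearMap.snd K V K) := by
  simp [twoStepFil, hj.not_ge, hkj]

theorem twoStepFil_of_lt {j : ℤ} (hj : j < 0) (hkj : j < k) : twoStepFil K V k j = ⊥ := by
  simp [twoStepFil, hj.not_ge, hkj.not_ge]

theorem pow_apply_inl (hN : ∀ v, N (v, 0) = (N' v, 0)) (l : ℕ) (v : V) :
    (N ^ l) (v, 0) = ((N' ^ l) v, 0) := by
  induction l generalizing v with
  | zero => rfl
  | succ l ih => rw [pow_succ, pow_succ, Module.End.mul_apply, Module.End.mul_apply, hN, ih]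

theorem pow_apply_snd (hN : ∀ v, (N v).2 = 0) {l : ℕ} (hl : l ≠ 0) (v : V × K) :
    ((N ^ l) v).2 = 0 := by
  obtain ⟨l, rfl⟩ := Nat.exists_eq_succ_of_ne_zero hl
  rw [pow_succ', Module.End.mul_apply, hN]

/-- A relative monodromy filtration restricts to the monodromy weight filtration of `N'`. -/
theorem IsRelMonodromyFil.comap_inl (hk : k ≤ -1) (hN : ∀ v, N (v, 0) = (N' v, 0))
    {M : ℤ → Submodule K (V × K)} (hM : IsRelMonodromyFil N (twoStepFil K V k) M) :
    IsWeightMonodromyFil N' k fun j => (M j).comap (LinearMap.inl K V K) := by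
  obtain ⟨mono, ⟨j₀, hj₀⟩, ⟨j₁, hj₁⟩, hNM, hbij⟩ := hM
  refine ⟨fun i j hij => Submodule.comap_mono (mono hij), ⟨j₀, fun j hj => ?_⟩,
    ⟨j₁, fun j hj => by simp [hj₁ j hj]⟩, ?_, fun l => ⟨fun x hx => ?_, fun x hx => ?_⟩⟩
  · simp only [hj₀ j hj]
    exact LinearMap.ker_eq_bot.2 LinearMap.inl_injective
  · rintro j _ ⟨x, hx, rfl⟩
    exact hNM j ⟨(x, 0), hx, hN x⟩
  · have hs := (hbij k l).1
    rw [twoStepFil_of_neg (by lia) le_rfl, twoStepFil_of_lt (by lia) (by lia), sup_bot_eq] at hs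
    obtain ⟨_, ⟨⟨y, s⟩, ⟨hy, rfl : s = 0⟩, rfl⟩, ⟨z, t⟩, ⟨hz, rfl : t = 0⟩, hyz⟩ :=
      Submodule.mem_sup.1 (@hs (x, 0) ⟨hx, rfl⟩)
    rw [pow_apply_inl hN, Prod.mk_add_mk, add_zero, Prod.mk.injEq] at hyz
    exact Submodule.mem_sup.2 ⟨_, ⟨y, hy, rfl⟩, z, hz, hyz.1⟩
  · have hs := (hbij k l).2
    rw [twoStepFil_of_neg (by lia) le_rfl, twoStepFil_of_lt (by lia) (by lia), sup_bot_eq,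
      sup_bot_eq] at hs
    refine (@hs (x, 0) ⟨⟨hx.1, rfl⟩, ?_⟩).1
    rw [SetLike.mem_coe, Submodule.mem_comap, pow_apply_inl hN]
    exact ⟨hx.2, rfl⟩

theorem IsRelMonodromyFil.sup_ker_snd (hk : k ≤ -1) (hN : ∀ v, (N v).2 = 0)
    {M : ℤ → Submodule K (V × K)} (hM : IsRelMonodromyFil N (twoStepFil K V k) M) :
    M 0 ⊔ LinearMap.ker (LinearMap.snd K V K) = ⊤ := by
  obtain ⟨mono, -, ⟨j₁, hj₁⟩, -, hbij⟩ := hM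
  have key : ∀ n : ℕ, M n ≤ M 0 ⊔ LinearMap.ker (LinearMap.snd K V K) := by
    intro n
    induction n with
    | zero => exact le_sup_left
    | succ n ih =>
      have hs := (hbij 0 (n + 1)).2
      rw [twoStepFil_of_nonneg le_rfl, twoStepFil_of_neg (j := 0 - 1) (by lia) (by lia)] at hs
      simp only [inf_top_eq] at hs
      intro x hx
      refine sup_le ((mono (by push_cast; lia)).trans ih) le_sup_right (hs ⟨?_, ?_⟩)
      · rwa [zero_add]
      · exact Submodule.mem_sup_right (pow_apply_snd hN n.succ_ne_zero x)
  exact top_le_iff.1 ((hj₁ j₁.toNat (by lia)).ge.trans (key _))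

/-- The filtration of `V × K` extending `W` with the vector `(-h, 1)` placed in degree `0`. -/
def extendFil (W : ℤ → Submodule K V) (h : V) (j : ℤ) : Submodule K (V × K) :=
  (W j).comap (LinearMap.fst K V K + (LinearMap.snd K V K).smulRight h) ⊓
    if 0 ≤ j then ⊤ else LinearMap.ker (LinearMap.snd K V K)

theorem mem_extendFil {W : ℤ → Submodule K V} {h : V} {j : ℤ} {v : V × K} :
    v ∈ extendFil W h j ↔ v.1 + v.2 • h ∈ W j ∧ (j < 0 → v.2 = 0) := by
  unfold extendFil
  split_ifs with hj
  · simp [hj.not_gt]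
  · simp [not_le.1 hj]

theorem inl_mem_extendFil {W : ℤ → Submodule K V} {h : V} {j : ℤ} {x : V} :
    (x, (0 : K)) ∈ extendFil W h j ↔ x ∈ W j := by
  simp [mem_extendFil]

theorem IsWeightMonodromyFil.isRelMonodromyFil_extendFil (hk : k ≤ -1)
    (hN₁ : ∀ v, (N v).2 = 0) (hN₂ : ∀ v, N (v, 0) = (N' v, 0)) {W : ℤ → Submodule K V}
    (hW : IsWeightMonodromyFil N' k W) {h : V} (hh : (N (0, 1)).1 - N' h ∈ W (-2)) :
    IsRelMonodromyFil N (twoStepFil K V k) (extendFil W h) := by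
  have hNfst (v : V × K) :
      (N v).1 = N' (v.1 + v.2 • h) + v.2 • ((N (0, 1)).1 - N' h) := by
    have hv : v = (v.1, 0) + v.2 • (0, 1) := by ext <;> simp
    conv_lhs => rw [hv, map_add, map_smul, hN₂]
    simp only [Prod.fst_add, Prod.smul_fst, map_add, map_smul, smul_sub]
    abel
  have ⟨mono, ⟨j₀, hj₀⟩, ⟨j₁, hj₁⟩, _, hbij⟩ := hW
  refine ⟨fun i j hij v hv => ?_, ⟨min j₀ (-1), fun j hj => ?_⟩, ⟨max j₁ 0, fun j hj => ?_⟩,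
    ?_, fun j l => ?_⟩
  · rw [mem_extendFil] at hv ⊢
    exact ⟨mono hij hv.1, fun hj => hv.2 (by lia)⟩
  · refine (Submodule.eq_bot_iff _).2 fun v hv => ?_
    obtain ⟨h1, h2⟩ := mem_extendFil.1 hv
    have h2 := h2 (by lia)
    rw [hj₀ j (by lia), h2, zero_smul, add_zero, Submodule.mem_bot] at h1
    exact Prod.ext h1 h2
  · refine top_le_iff.1 fun v _ => mem_extendFil.2 ⟨?_, fun hj' => by lia⟩
    rw [hj₁ j (by lia)]
    trivial
  · rintro j _ ⟨v, hv, rfl⟩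
    obtain ⟨h1, h2⟩ := mem_extendFil.1 hv
    refine mem_extendFil.2 ⟨?_, fun _ => hN₁ v⟩
    rw [hN₁, zero_smul, add_zero, hNfst]
    refine add_mem (hW.apply_mem le_rfl h1) ?_
    obtain hj | hj := lt_or_ge j 0
    · simp [h2 hj]
    · exact Submodule.smul_mem _ _ (mono (by lia) hh)
  · obtain rfl | hj0 := eq_or_ne j 0
    · rw [twoStepFil_of_nonneg le_rfl, twoStepFil_of_neg (j := 0 - 1) (by lia) (by lia)]
      simp only [inf_top_eq]
      obtain rfl | hl := eq_or_ne l 0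
      · refine ⟨?_, ?_⟩
        · simp only [pow_zero, Module.End.one_eq_id, Submodule.map_id]
          exact le_sup_of_le_left (le_sup_of_le_left (by simp))
        · simp only [pow_zero, Module.End.one_eq_id, Submodule.comap_id]
          exact inf_le_right.trans (by simp)
      · refine ⟨fun v hv => Submodule.mem_sup_right ((mem_extendFil.1 hv).2 (by lia)),
          fun v _ => ?_⟩
        refine Submodule.mem_sup.2 ⟨v.2 • (-h, 1), ?_, (v.1 + v.2 • h, 0), rfl, ?_⟩
        · exact Submodule.smul_mem _ _ (mem_extendFil.2 ⟨by simp, fun _ => by lia⟩)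
        · ext <;> simp
    · obtain rfl | hjk := eq_or_ne j k
      · rw [twoStepFil_of_neg (by lia) le_rfl, twoStepFil_of_lt (by lia) (by lia)]
        simp only [sup_bot_eq]
        refine ⟨?_, ?_⟩
        · rintro ⟨x, t⟩ ⟨hx, rfl : t = 0⟩
          obtain ⟨_, ⟨y, hy, rfl⟩, z, hz, rfl⟩ :=
            Submodule.mem_sup.1 ((hbij l).1 (inl_mem_extendFil.1 hx))
          refine Submodule.mem_sup.2 ⟨_, ⟨(y, 0), ⟨inl_mem_extendFil.2 hy, rfl⟩, rfl⟩,
            (z, 0), ⟨inl_mem_extendFil.2 hz, rfl⟩, ?_⟩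
          rw [pow_apply_inl hN₂, Prod.mk_add_mk, add_zero]
        · rintro ⟨x, t⟩ ⟨⟨hx, rfl : t = 0⟩, hx'⟩
          rw [SetLike.mem_coe, Submodule.mem_comap, pow_apply_inl hN₂] at hx'
          exact ⟨inl_mem_extendFil.2 ((hbij l).2
            ⟨inl_mem_extendFil.1 hx, inl_mem_extendFil.1 hx'.1⟩), rfl⟩
      · have hconst : twoStepFil K V k (j - 1) = twoStepFil K V k j := by
          obtain hj | hj := lt_or_ge j 0
          · obtain hj' | hj' := lt_or_ge j k
            · rw [twoStepFil_of_lt hj hj', twoStepFil_of_lt (by lia) (by lia)]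
            · rw [twoStepFil_of_neg hj hj', twoStepFil_of_neg (by lia) (by lia)]
          · rw [twoStepFil_of_nonneg hj, twoStepFil_of_nonneg (by lia)]
        rw [hconst]
        exact ⟨inf_le_right.trans le_sup_right,
          (inf_le_left.trans inf_le_right).trans le_sup_right⟩

end OneDimensionalExtension

/-- Fact 1 of §11: with `H = H' ⊕ ℝ`, `e = (0,1)`, `W` the filtration with
`gr^W_0 = ℝ·e`, `gr^W_k = H'` (`k ≤ -1`), and `W'` the weight filtration of `N'` centered
at `k`, a linear map `N : H → H` with `N(H) ⊆ H'` and `N|_{H'} = N'` admits a relative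
monodromy filtration `M(N, W)` iff `N(e) ∈ N'(H') + W'_{-2}`. -/
theorem stmt1 (H' : Type*) [AddCommGroup H'] [Module ℝ H'] [FiniteDimensional ℝ H']
    (N' : H' →ₗ[ℝ] H') (hnil : IsNilpotent N')
    (k : ℤ) (hk : k ≤ -1)
    -- `W'` is the monodromy weight filtration of `N'` centered at `k`
    (W' : ℤ → Submodule ℝ H') (hW' : IsWeightMonodromyFil N' k W')
    (N : (H' × ℝ) →ₗ[ℝ] (H' × ℝ))
    -- `N(H) ⊆ H'`
    (hN1 : ∀ v : H' × ℝ, (N v).2 = 0)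
    -- the restriction of `N` to `H'` is `N'`
    (hN2 : ∀ v : H', N (v, 0) = (N' v, 0)) :
    (∃ M : ℤ → Submodule ℝ (H' × ℝ),
        IsRelMonodromyFil N
          (fun j => if 0 ≤ j then ⊤
            else if k ≤ j then LinearMap.ker (LinearMap.snd ℝ H' ℝ) else ⊥) M) ↔
      (N ((0 : H'), (1 : ℝ))).1 ∈ LinearMap.range N' ⊔ W' (-2) := by
  constructor
  · rintro ⟨M, hM⟩
    change IsRelMonodromyFil N (twoStepFil ℝ H' k) M at hM
    obtain ⟨v, hv, ⟨y, t⟩, rfl : t = 0, hvy⟩ :=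
      Submodule.mem_sup.1 ((hM.sup_ker_snd hk hN1).ge (Submodule.mem_top (x := ((0 : H'), (1 : ℝ)))))
    have hNv : N v = ((N v).1, 0) := Prod.ext rfl (hN1 v)
    have hmem : (N v).1 ∈ W' (-2) := by
      rw [hW'.unique (hM.comap_inl hk hN2)]
      change ((N v).1, (0 : ℝ)) ∈ M (-2)
      rw [← hNv]
      exact hM.2.2.2.1 0 ⟨v, hv, rfl⟩
    refine Submodule.mem_sup.2 ⟨N' y, ⟨y, rfl⟩, _, hmem, ?_⟩
    rw [← hvy, map_add, hN2, Prod.fst_add, add_comm]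
  · intro hmem
    obtain ⟨_, ⟨h, rfl⟩, w, hw, hhw⟩ := Submodule.mem_sup.1 hmem
    exact ⟨extendFil W' h, hW'.isRelMonodromyFil_extendFil hk hN1 hN2
      (by rwa [← hhw, add_sub_cancel_left])⟩
end

section
/- Let N₁, …, N_t : H_ℚ → H_ℚ be mutually commuting ℚ-linear maps with Nᵢ(H_ℚ) ⊆ H'_ℚ for all i, such that for each i the restriction of Nᵢ to H'_ℚ is a nonnegative rational multiple of N'. Let σ ⊆ End_ℝ(H_ℝ) be the set of all nonnegative-real linear combinations of the ℝ-linear extensions of N₁, …, N_t. Assume that σ ∩ (−σ) = {0} and that every N ∈ σ admits a relative monodromy filtration M(N,W). Then there exist finitely many cones σ₁, …, σ_u ⊆ End_ℝ(H_ℝ), each equal to the set of nonnegative-real linear combinations of finitely many ℝ-linear extensions of ℚ-linear endomorphisms of H_ℚ, such that σ = σ₁ ∪ ⋯ ∪ σ_u and each σ_i is contained in σ(x,n) for some x ∈ P/Q and n ∈ ℤ^m. -/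
open Matrix

noncomputable section

/-- Index type for `H = H' ⊕ ℤ` (with `H'` free of rank `d`): `Sum.inl i` indexes the
`H'`-coordinates and `Sum.inr ()` indexes the extra ℤ-coordinate (the coordinate of `e`). -/
abbrev Idx (d : ℕ) := Sum (Fin d) Unit

/-- `N' = log γ' = Σ_{i≥1} (-1)^{i+1} (γ'-1)^i / i` as a rational `d × d` matrix
(the series is finite: since `γ' - 1` is nilpotent, `(γ'-1)^i = 0` for `i > d`). -/
def logMat (d : ℕ) (γ' : (Matrix (Fin d) (Fin d) ℤ)ˣ) : Matrix (Fin d) (Fin d) ℚ :=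
  ∑ i ∈ Finset.Icc 1 d,
    ((-1 : ℚ) ^ (i + 1) / (i : ℚ)) •
      ((γ' : Matrix (Fin d) (Fin d) ℤ).map (Int.cast : ℤ → ℚ) - 1) ^ i

/-- `P = Im(N' : H'_ℚ → H'_ℚ)`. -/
def Psub (d : ℕ) (γ' : (Matrix (Fin d) (Fin d) ℤ)ˣ) : Submodule ℚ (Fin d → ℚ) :=
  LinearMap.range (logMat d γ').mulVecLin

/-- `Q = Ker(N' : H'_ℚ → H'_ℚ) ∩ P`. -/
def Qsub (d : ℕ) (γ' : (Matrix (Fin d) (Fin d) ℤ)ˣ) : Submodule ℚ (Fin d → ℚ) :=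
  LinearMap.ker (logMat d γ').mulVecLin ⊓ Psub d γ'

/-- `Q` regarded as a submodule of `P` (note `Q ⊆ P`). -/
def QinP (d : ℕ) (γ' : (Matrix (Fin d) (Fin d) ℤ)ˣ) : Submodule ℚ (Psub d γ') :=
  (Qsub d γ').comap (Psub d γ').subtype

/-- The quotient `P/Q`. -/
abbrev PmodQ (d : ℕ) (γ' : (Matrix (Fin d) (Fin d) ℤ)ˣ) :=
  (Psub d γ') ⧸ (QinP d γ')

/-- `a(x)`: the order of the image of `x ∈ P/Q` in `P/((P∩L)+Q)`, i.e. the least positive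
integer `a` such that `a • x` is the class of an element of `P ∩ L`. -/
def aOrd (d : ℕ) (γ' : (Matrix (Fin d) (Fin d) ℤ)ˣ) (L : Submodule ℤ (Fin d → ℚ))
    (x : PmodQ d γ') : ℕ :=
  sInf {a : ℕ | 0 < a ∧ ∃ v : Psub d γ', (v : Fin d → ℚ) ∈ L ∧ (QinP d γ').mkQ v = a • x}

/-- The generating set `G(x,n)` of the cone `σ(x,n)`: all real matrices `N` (identified with
ℝ-linear endomorphisms of `H_ℝ = Idx d → ℝ` via `N.mulVec`) such that `N(H_ℝ) ⊆ H'_ℝ`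
(the `Sum.inr`-row vanishes), the restriction of `N` to `H'_ℝ` is `N'` (the `inl × inl` block
is `N'`), and `N(e) = s(x) + a(x)⁻¹ Σ_j c_j e_j` with `n_j ≤ c_j ≤ n_j + 1`. -/
def Gset (d m : ℕ) (γ' : (Matrix (Fin d) (Fin d) ℤ)ˣ) (L : Submodule ℤ (Fin d → ℚ))
    (s : PmodQ d γ' →ₗ[ℚ] Psub d γ') (E : Fin m → (Fin d → ℚ))
    (x : PmodQ d γ') (n : Fin m → ℤ) : Set (Matrix (Idx d) (Idx d) ℝ) :=
  {N | (∀ j, N (Sum.inr ()) j = 0) ∧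
    (∀ i j : Fin d, N (Sum.inl i) (Sum.inl j) = (logMat d γ' i j : ℝ)) ∧
    ∃ c : Fin m → ℝ, (∀ j, (n j : ℝ) ≤ c j ∧ c j ≤ (n j : ℝ) + 1) ∧
      ∀ i : Fin d, N (Sum.inl i) (Sum.inr ()) =
        (((s x : Psub d γ') : Fin d → ℚ) i : ℝ) +
          ((aOrd d γ' L x : ℝ))⁻¹ * ∑ j, c j * ((E j i : ℝ))}

/-- The set of all finite nonnegative-real linear combinations of elements of `S`. -/
def coneOf {V : Type*} [AddCommMonoid V] [Module ℝ V] (S : Set V) : Set V :=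
  {M | ∃ (t : ℕ) (f : Fin t → V) (r : Fin t → ℝ),
    (∀ k, f k ∈ S) ∧ (∀ k, 0 ≤ r k) ∧ M = ∑ k, r k • f k}

/-- The cone `σ(x,n)`: all finite nonnegative-real linear combinations of elements of `G(x,n)`. -/
def sigmaCone (d m : ℕ) (γ' : (Matrix (Fin d) (Fin d) ℤ)ˣ) (L : Submodule ℤ (Fin d → ℚ))
    (s : PmodQ d γ' →ₗ[ℚ] Psub d γ') (E : Fin m → (Fin d → ℚ))
    (x : PmodQ d γ') (n : Fin m → ℤ) : Set (Matrix (Idx d) (Idx d) ℝ) :=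
  coneOf (Gset d m γ' L s E x n)

/-- The weight filtration `W` on `H_ℝ = Idx d → ℝ`: `W_j = H_ℝ` for `j ≥ 0`,
`W_{-1} = H'_ℝ` (the functions vanishing at `Sum.inr ()`), and `W_j = 0` for `j ≤ -2`. -/
def Wfil (d : ℕ) : ℤ → Submodule ℝ (Idx d → ℝ) := fun j =>
  if 0 ≤ j then ⊤
  else if j = -1 then
    LinearMap.ker (LinearMap.proj (Sum.inr ()) : ((_ : Idx d) → ℝ) →ₗ[ℝ] ℝ)
  else ⊥

/-- A convex cone in a real vector space: contains `0`, closed under addition and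
multiplication by nonnegative reals. -/
def IsConvexConeSet {V : Type*} [AddCommMonoid V] [Module ℝ V] (S : Set V) : Prop :=
  (0 : V) ∈ S ∧ (∀ u ∈ S, ∀ v ∈ S, u + v ∈ S) ∧ ∀ r : ℝ, 0 ≤ r → ∀ u ∈ S, r • u ∈ S

/-- `F` is a face of the convex cone `S`. -/
def IsFaceOf {V : Type*} [AddCommMonoid V] [Module ℝ V] (F S : Set V) : Prop :=
  IsConvexConeSet F ∧ F ⊆ S ∧ ∀ u ∈ S, ∀ v ∈ S, u + v ∈ F → u ∈ F ∧ v ∈ F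

/-- The ray of all nonnegative real multiples of `N`. -/
def rayOf {V : Type*} [AddCommMonoid V] [Module ℝ V] (N : V) : Set V :=
  {M | ∃ r : ℝ, 0 ≤ r ∧ M = r • N}

end

open scoped NNReal in
/-- The part of a finitely generated cone on which a linear form is nonnegative contains finitely
many vectors, rational if the given generators and the form are, which generate it. -/
theorem exists_finite_generators_inter_halfspace {V : Type*} [AddCommGroup V] [Module ℝ V]
    [Module ℚ V] (R : Submodule ℚ V) (A : Set V) (hA : A.Finite) (hAR : A ⊆ R)
    (F : V →ₗ[ℝ] ℝ) (hF : ∀ v ∈ R, ∃ q : ℚ, F v = q) :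
    ∃ B : Set V, B.Finite ∧ B ⊆ R ∧ B ⊆ Submodule.span ℝ≥0 A ∧ (∀ b ∈ B, 0 ≤ F b) ∧
      ∀ x ∈ Submodule.span ℝ≥0 A, 0 ≤ F x → x ∈ Submodule.span ℝ≥0 B := by
  set P : Set V := {a ∈ A | 0 ≤ F a} with hP
  set N : Set V := {a ∈ A | F a < 0} with hN
  set X : Set V := Set.image2 (fun p n => F p • n - F n • p) P N with hX
  have hPfin : P.Finite := hA.subset (Set.sep_subset _ _)
  have hNfin : N.Finite := hA.subset (Set.sep_subset _ _)
  have hPN : A = P ∪ N := by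
    ext a
    simp only [hP, hN, Set.mem_union, Set.mem_ofPred_eq]
    grind
  have smul_mem (S : Submodule ℝ≥0 V) (r : ℝ) (hr : 0 ≤ r) (v : V) (hv : v ∈ S) : r • v ∈ S :=
    S.smul_mem (⟨r, hr⟩ : ℝ≥0) hv
  refine ⟨P ∪ X, hPfin.union (hPfin.image2 _ hNfin), ?_, ?_, ?_, ?_⟩
  · rintro v (hv | ⟨p, hp, n, hn, rfl⟩)
    · exact hAR hv.1
    · obtain ⟨a, ha⟩ := hF p (hAR hp.1)
      obtain ⟨b, hb⟩ := hF n (hAR hn.1)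
      simp only [ha, hb, Rat.cast_smul_eq_qsmul]
      exact R.sub_mem (R.smul_mem _ (hAR hn.1)) (R.smul_mem _ (hAR hp.1))
  · rintro v (hv | ⟨p, hp, n, hn, rfl⟩)
    · exact Submodule.subset_span hv.1
    · simp only [sub_eq_add_neg, ← neg_smul]
      exact add_mem (smul_mem _ _ hp.2 _ (Submodule.subset_span hn.1))
        (smul_mem _ _ (neg_nonneg.2 hn.2.le) _ (Submodule.subset_span hp.1))
  · rintro v (hv | ⟨p, hp, n, hn, rfl⟩)
    · exact hv.2
    · simp [mul_comm]
  · intro x hx hFx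
    rw [hPN, Submodule.span_union, Submodule.mem_sup] at hx
    obtain ⟨p, hp, n, hn, rfl⟩ := hx
    have hmix : F p • n - F n • p ∈ Submodule.span ℝ≥0 X := by
      clear hFx
      induction hp using Submodule.span_induction with
      | zero => simp
      | add a b _ _ iha ihb =>
        convert add_mem iha ihb using 1
        simp only [map_add, add_smul, smul_add]; abel
      | smul r a _ iha =>
        convert Submodule.smul_mem _ r iha using 1
        simp only [NNReal.smul_def, map_smul, smul_sub, smul_smul, smul_eq_mul]
        ring_nf
      | mem a ha =>
        induction hn using Submodule.span_induction with
        | zero => simp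
        | add u v _ _ iha ihb =>
          convert add_mem iha ihb using 1
          simp only [map_add, add_smul, smul_add]; abel
        | smul r a _ iha =>
          convert Submodule.smul_mem _ r iha using 1
          simp only [NNReal.smul_def, map_smul, smul_sub, smul_smul, smul_eq_mul]
          ring_nf
        | mem b hb => exact Submodule.subset_span ⟨a, ha, b, hb, rfl⟩
    have hneg : n = 0 ∨ F n < 0 := by
      clear hFx hmix
      induction hn using Submodule.span_induction with
      | zero => exact Or.inl rfl
      | mem b hb => exact Or.inr hb.2
      | add u v _ _ ihu ihv =>
        rcases ihu with rfl | hu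
        · simpa using ihv
        · rcases ihv with rfl | hv
          · simpa using Or.inr hu
          · exact Or.inr (by simpa using add_neg hu hv)
      | smul r u _ ihu =>
        rcases ihu with rfl | hu
        · simp
        · rcases eq_or_ne r 0 with rfl | hr
          · simp
          · right
            rw [NNReal.smul_def, map_smul, smul_eq_mul]
            exact mul_neg_of_pos_of_neg (by positivity) hu
    rw [map_add] at hFx
    have hpB : p ∈ Submodule.span ℝ≥0 (P ∪ X) := Submodule.span_mono Set.subset_union_left hp
    rcases hneg with rfl | hneg
    · simpa using hpB
    · have hpos : 0 < F p := by linarith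
      have hsum : p + n =
          (F p)⁻¹ • ((F p • n - F n • p) + (F p + F n) • p) := by
        rw [eq_inv_smul_iff₀ hpos.ne']
        simp only [smul_add, add_smul]
        abel
      rw [hsum]
      exact smul_mem _ _ (inv_nonneg.2 hpos.le) _
        (add_mem (Submodule.span_mono Set.subset_union_right hmix) (smul_mem _ _ hFx _ hpB))

open scoped NNReal in
/-- A rational finitely generated cone is subdivided by finitely many rational linear forms into
finitely many rational finitely generated cones on each of which every form has constant sign. -/
theorem exists_finite_subdivision {V : Type*} [AddCommGroup V] [Module ℝ V]
    [Module ℚ V] (R : Submodule ℚ V) (fs : List (V →ₗ[ℝ] ℝ))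
    (hfs : ∀ F ∈ fs, ∀ v ∈ R, ∃ q : ℚ, F v = q) (A : Set V) (hA : A.Finite) (hAR : A ⊆ R) :
    ∃ 𝓑 : Set (Set V), 𝓑.Finite ∧
      (∀ B ∈ 𝓑, B.Finite ∧ B ⊆ R ∧ B ⊆ Submodule.span ℝ≥0 A ∧
        ∀ F ∈ fs, (∀ b ∈ B, 0 ≤ F b) ∨ (∀ b ∈ B, F b ≤ 0)) ∧
      ∀ x ∈ Submodule.span ℝ≥0 A, ∃ B ∈ 𝓑, x ∈ Submodule.span ℝ≥0 B := by
  have nonneg_span (F : V →ₗ[ℝ] ℝ) (B : Set V) (hB : ∀ b ∈ B, 0 ≤ F b) :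
      ∀ x ∈ Submodule.span ℝ≥0 B, 0 ≤ F x := by
    intro x hx
    induction hx using Submodule.span_induction with
    | zero => simp
    | mem b hb => exact hB b hb
    | add u v _ _ hu hv => simpa using add_nonneg hu hv
    | smul r u _ hu =>
      rw [NNReal.smul_def, map_smul, smul_eq_mul]
      exact mul_nonneg r.2 hu
  induction fs generalizing A with
  | nil =>
    exact ⟨{A}, Set.finite_singleton A,
      by rintro B rfl; exact ⟨hA, hAR, Submodule.subset_span, by simp⟩,
      fun x hx => ⟨A, rfl, hx⟩⟩
  | cons F fs ih =>
    have hF := hfs F (by simp)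
    have ih := ih fun G hG => hfs G (by simp [hG])
    obtain ⟨B, hBfin, hBR, hBA, hBF, hB⟩ :=
      exists_finite_generators_inter_halfspace R A hA hAR F hF
    obtain ⟨C, hCfin, hCR, hCA, hCF, hC⟩ :=
      exists_finite_generators_inter_halfspace R A hA hAR (-F) (fun v hv => by
        obtain ⟨q, hq⟩ := hF v hv
        exact ⟨-q, by simp [hq]⟩)
    obtain ⟨𝓑, h𝓑fin, h𝓑, h𝓑c⟩ := ih B hBfin hBR
    obtain ⟨𝓒, h𝓒fin, h𝓒, h𝓒c⟩ := ih C hCfin hCR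
    refine ⟨𝓑 ∪ 𝓒, h𝓑fin.union h𝓒fin, ?_, ?_⟩
    · rintro D (hD | hD)
      · obtain ⟨h1, h2, h3, h4⟩ := h𝓑 D hD
        refine ⟨h1, h2, h3.trans (Submodule.span_le.2 hBA), ?_⟩
        intro G hG
        rcases List.mem_cons.1 hG with rfl | hG
        · exact Or.inl fun b hb => nonneg_span _ B hBF b (h3 hb)
        · exact h4 G hG
      · obtain ⟨h1, h2, h3, h4⟩ := h𝓒 D hD
        refine ⟨h1, h2, h3.trans (Submodule.span_le.2 hCA), ?_⟩
        intro G hG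
        rcases List.mem_cons.1 hG with rfl | hG
        · exact Or.inr fun b hb => by simpa using nonneg_span _ C hCF b (h3 hb)
        · exact h4 G hG
    · intro x hx
      rcases le_total 0 (F x) with h | h
      · obtain ⟨D, hD, hxD⟩ := h𝓑c x (hB x hx h)
        exact ⟨D, Or.inl hD, hxD⟩
      · obtain ⟨D, hD, hxD⟩ := h𝓒c x (hC x hx (by simpa using h))
        exact ⟨D, Or.inr hD, hxD⟩

/-- Between a sign `≥ 0` and a later sign `≤ 0`, there are two consecutive such signs. -/
theorem exists_consecutive_of_forall_or {P R : ℕ → Prop} (h : ∀ i, P i ∨ R i) (h0 : P 0)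
    {n : ℕ} (hn : R (n + 1)) : ∃ i, P i ∧ R (i + 1) := by
  classical
  have hex : ∃ i, R (i + 1) := ⟨n, hn⟩
  refine ⟨Nat.find hex, ?_, Nat.find_spec hex⟩
  rcases hi : Nat.find hex with _ | i
  · exact h0
  · exact (h (i + 1)).resolve_right (Nat.find_min hex (by omega))

/-- If `N` maps `H` to `H'` and has a relative monodromy filtration, then `N(H) = N(H')`. -/
theorem IsRelMonodromyFil.exists_mulVec_eq {d : ℕ} {N : Matrix (Idx d) (Idx d) ℝ}
    (hN : ∀ j, N (Sum.inr ()) j = 0) {M : ℤ → Submodule ℝ (Idx d → ℝ)}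
    (hM : IsRelMonodromyFil (Matrix.mulVecLin N) (Wfil d) M) (v : Idx d → ℝ) :
    ∃ h : Idx d → ℝ, h (Sum.inr ()) = 0 ∧ N.mulVec v = N.mulVec h := by
  obtain ⟨-, ⟨j₀, hj₀⟩, ⟨j₁, hj₁⟩, hshift, hgr⟩ := hM
  set K := LinearMap.ker (LinearMap.proj (Sum.inr ()) : ((_ : Idx d) → ℝ) →ₗ[ℝ] ℝ) with hK
  have memK (u : Idx d → ℝ) : u ∈ K ↔ u (Sum.inr ()) = 0 := by simp [hK]
  have hW0 : Wfil d 0 = ⊤ := by simp [Wfil]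
  have hW1 : Wfil d (-1) = K := by simp [Wfil, hK]
  have hW2 : Wfil d (-2) = ⊥ := by simp [Wfil]
  have hNK (u : Idx d → ℝ) : Matrix.mulVecLin N u ∈ K := by
    rw [memK]
    simp [Matrix.mulVec, dotProduct, hN]
  have hup (l : ℕ) : M l ≤ M 0 ⊔ K := by
    induction l with
    | zero => exact le_sup_left
    | succ l ih =>
      have h := (hgr 0 (l + 1)).2
      have h1 : (0 : ℤ) + ((l + 1 : ℕ) : ℤ) - 1 = l := by push_cast; ring
      rw [h1, zero_add, zero_sub (1 : ℤ), hW0, hW1, inf_top_eq, inf_top_eq, inf_top_eq] at h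
      refine le_trans (fun u hu => h ⟨hu, ?_⟩) (sup_le ih le_sup_right)
      rw [SetLike.mem_coe, Submodule.mem_comap, pow_succ']
      exact Submodule.mem_sup_right (hNK _)
  have hdown (k l : ℕ) : M (-1 - (l + 1 : ℕ)) ⊓ K ≤
      K.map (Matrix.mulVecLin N) ⊔ M (-1 - (l + 1 + k : ℕ)) ⊓ K := by
    induction k with
    | zero => exact le_sup_right
    | succ k ih =>
      refine ih.trans (sup_le le_sup_left ?_)
      have h := (hgr (-1) (l + 1 + k)).1
      have h1 : (-1 : ℤ) - ((l + 1 + k : ℕ) : ℤ) - 1 = -1 - ((l + 1 + (k + 1) : ℕ) : ℤ) := by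
        push_cast; ring
      have h2 : (-1 : ℤ) - 1 = -2 := by norm_num
      rw [h1, h2, hW1, hW2, sup_bot_eq] at h
      refine h.trans (sup_le_sup_right ?_ _)
      rintro _ ⟨u, hu, rfl⟩
      rw [show l + 1 + k = (l + k) + 1 by ring, pow_succ']
      refine ⟨(Matrix.mulVecLin N ^ (l + k)) u, ?_, rfl⟩
      rcases l + k with _ | i
      · exact hu.2
      · rw [pow_succ']; exact hNK _
  have hv : v ∈ M 0 ⊔ K := by
    refine hup j₁.toNat ?_
    rw [hj₁ _ (Int.self_le_toNat j₁)]
    trivial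
  obtain ⟨a, ha, b, hb, rfl⟩ := Submodule.mem_sup.1 hv
  have hNa : Matrix.mulVecLin N a ∈ K.map (Matrix.mulVecLin N) := by
    have h := hdown (-j₀).toNat 0 ⟨by simpa using hshift 0 ⟨a, ha, rfl⟩, hNK a⟩
    rw [hj₀ _ (by push_cast; have := Int.self_le_toNat (-j₀); omega), bot_inf_eq, sup_bot_eq] at h
    exact h
  obtain ⟨c, hc, hca⟩ := hNa
  refine ⟨c + b, (memK _).1 (add_mem hc hb), ?_⟩
  rw [Matrix.mulVec_add, Matrix.mulVec_add]
  congr 1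
  exact hca.symm

/-- A rational linear system which is solvable over `ℝ` is solvable over `ℚ`. -/
theorem exists_rat_mulVec_eq {m n : Type*} [Fintype m] [Fintype n]
    (A : Matrix m n ℚ) (v : m → ℚ) (h : n → ℝ)
    (hv : (A.map (Rat.cast : ℚ → ℝ)).mulVec h = fun i => (v i : ℝ)) :
    ∃ w : n → ℚ, A.mulVec w = v := by
  classical
  by_contra hcon
  have hnot : v ∉ LinearMap.range A.mulVecLin := by
    rintro ⟨w, hw⟩
    exact hcon ⟨w, hw⟩
  obtain ⟨f, hfv, hf⟩ := Submodule.exists_le_ker_of_notMem hnot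
  have hfe (u : m → ℚ) : f u = ∑ i, u i * f (Pi.single i 1) := by
    rw [f.pi_apply_eq_sum_univ u]
    refine Finset.sum_congr rfl fun i _ => ?_
    rw [smul_eq_mul]
    congr 2
    ext j
    simp [Pi.single_apply, eq_comm]
  have hA (j : n) : ∑ i, A i j * f (Pi.single i 1) = 0 := by
    rw [← hfe]
    have : (fun i => A i j) = A.mulVecLin (Pi.single j 1) := by
      ext i; simp
    rw [this]
    exact hf ⟨_, rfl⟩
  apply hfv
  rw [hfe]
  have : ((∑ i, v i * f (Pi.single i 1) : ℚ) : ℝ) = 0 := by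
    push_cast
    have hvi (i : m) : (v i : ℝ) = ∑ j, (A i j : ℝ) * h j := by
      rw [← congrFun hv i]; rfl
    simp_rw [hvi, Finset.sum_mul]
    rw [Finset.sum_comm]
    refine Finset.sum_eq_zero fun j _ => ?_
    have := congrArg (Rat.cast : ℚ → ℝ) (hA j)
    push_cast at this
    rw [← zero_mul (h j), ← this, Finset.sum_mul]
    exact Finset.sum_congr rfl fun i _ => by ring
  exact_mod_cast this

open scoped NNReal in
/-- A rational finitely generated cone in `ℝ × ℝ^m`, contained in the cone over the cube
`[-K, K]^m`, is a finite union of rational finitely generated cones each contained in the cone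
over a unit cube with integral vertices. -/
theorem exists_finite_cube_subdivision {m : ℕ} (A : Set (Option (Fin m) → ℝ)) (hA : A.Finite)
    (hAR : A ⊆ LinearMap.range ((Algebra.linearMap ℚ ℝ).compLeft (Option (Fin m)))) (K : ℕ)
    (hK : 0 < K) (hA0 : ∀ a ∈ A, 0 ≤ a none) (hAK : ∀ a ∈ A, ∀ j, |a (some j)| ≤ K * a none) :
    ∃ 𝓑 : Set (Set (Option (Fin m) → ℝ)), 𝓑.Finite ∧
      (∀ B ∈ 𝓑, B.Finite ∧
        B ⊆ LinearMap.range ((Algebra.linearMap ℚ ℝ).compLeft (Option (Fin m))) ∧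
        B ⊆ Submodule.span ℝ≥0 A ∧
        ∃ n : Fin m → ℤ, ∀ b ∈ B, 0 ≤ b none ∧
          ∀ j, n j * b none ≤ b (some j) ∧ b (some j) ≤ (n j + 1) * b none) ∧
      ∀ x ∈ Submodule.span ℝ≥0 A, ∃ B ∈ 𝓑, x ∈ Submodule.span ℝ≥0 B := by
  have hspan : ∀ x ∈ Submodule.span ℝ≥0 A,
      0 ≤ x none ∧ ∀ j, |x (some j)| ≤ K * x none := by
    intro x hx
    induction hx using Submodule.span_induction with
    | zero => simp
    | mem a ha => exact ⟨hA0 a ha, hAK a ha⟩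
    | add u v _ _ hu hv =>
      refine ⟨add_nonneg hu.1 hv.1, fun j => (abs_add_le _ _).trans ?_⟩
      simpa [mul_add] using add_le_add (hu.2 j) (hv.2 j)
    | smul r u _ hu =>
      refine ⟨mul_nonneg r.2 hu.1, fun j => ?_⟩
      have := mul_le_mul_of_nonneg_left (hu.2 j) r.2
      simp only [NNReal.val_eq_coe] at this
      simp only [NNReal.smul_def, Pi.smul_apply, smul_eq_mul, abs_mul, NNReal.abs_eq]
      linarith
  let F (j : Fin m) (i : ℕ) : (Option (Fin m) → ℝ) →ₗ[ℝ] ℝ :=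
    LinearMap.proj (some j) - ((i : ℝ) - K) • LinearMap.proj none
  have hF (j : Fin m) (i : ℕ) (v : Option (Fin m) → ℝ) :
      F j i v = v (some j) - ((i : ℝ) - K) * v none := rfl
  obtain ⟨𝓑, h𝓑fin, h𝓑, h𝓑c⟩ := exists_finite_subdivision
    (LinearMap.range ((Algebra.linearMap ℚ ℝ).compLeft (Option (Fin m))))
    ((List.finRange m ×ˢ List.range (2 * K)).map fun p => F p.1 p.2)
    (by
      simp only [List.mem_map]
      rintro _ ⟨⟨j, i⟩, -, rfl⟩ _ ⟨w, rfl⟩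
      exact ⟨w (some j) - ((i : ℚ) - K) * w none, by simp [hF]⟩) A hA hAR
  refine ⟨𝓑, h𝓑fin, fun B hB => ?_, h𝓑c⟩
  obtain ⟨hBfin, hBR, hBA, hBF⟩ := h𝓑 B hB
  have hlarge (j : Fin m) (i : ℕ) (hi : 2 * K ≤ i) : ∀ b ∈ B, F j i b ≤ 0 := by
    intro b hb
    obtain ⟨h0, h1⟩ := hspan b (hBA hb)
    have hi' : (K : ℝ) ≤ i - K := by
      have : (2 * K : ℝ) ≤ i := by exact_mod_cast hi
      linarith
    rw [hF, sub_nonpos]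
    exact (abs_le.1 (h1 j)).2.trans (mul_le_mul_of_nonneg_right hi' h0)
  have hstep (j : Fin m) :
      ∃ i : ℕ, (∀ b ∈ B, 0 ≤ F j i b) ∧ ∀ b ∈ B, F j (i + 1) b ≤ 0 := by
    refine exists_consecutive_of_forall_or
      (P := fun i => ∀ b ∈ B, 0 ≤ F j i b) (R := fun i => ∀ b ∈ B, F j i b ≤ 0)
      (n := 2 * K - 1) (fun i => ?_) ?_ (hlarge j _ (by omega))
    · rcases lt_or_ge i (2 * K) with hi | hi
      · exact hBF _ (List.mem_map.2 ⟨(j, i), by simp [hi], rfl⟩)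
      · exact Or.inr (hlarge j i hi)
    · intro b hb
      obtain ⟨h0, h1⟩ := hspan b (hBA hb)
      rw [hF]
      have := (abs_le.1 (h1 j)).1
      push_cast
      linarith
  choose i hi using hstep
  refine ⟨hBfin, hBR, hBA, fun j => (i j : ℤ) - K, fun b hb => ⟨(hspan b (hBA hb)).1, fun j => ?_⟩⟩
  have h1 := (hi j).1 b hb
  have h2 := (hi j).2 b hb
  rw [hF] at h1 h2
  push_cast at h2 ⊢
  constructor <;> linarith

/-- The matrix with restriction `q N'` to `H'`, with zero last row and with last column
`q y + a⁻¹ Σ_j c_j e_j`, as a linear function of `(q, c)`. -/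
def cubeMatrix (k : Type*) [Field k] [CharZero k] {d m : ℕ} (N' : Matrix (Fin d) (Fin d) ℚ)
    (y : Fin d → ℚ) (a : ℕ) (E : Fin m → Fin d → ℚ) :
    (Option (Fin m) → k) →ₗ[k] Matrix (Idx d) (Idx d) k where
  toFun v := Matrix.fromBlocks (Matrix.of fun i j => v none * (N' i j : k))
    (Matrix.of fun i _ => v none * (y i : k) + (a : k)⁻¹ * ∑ j, v (some j) * (E j i : k)) 0 0
  map_add' u v := by
    ext (i | i) (j | j) <;>
      simp only [Matrix.fromBlocks_apply₁₁, Matrix.fromBlocks_apply₁₂, Matrix.fromBlocks_apply₂₁,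
        Matrix.fromBlocks_apply₂₂, Matrix.add_apply, Matrix.of_apply, Pi.add_apply, add_mul,
        Finset.sum_add_distrib, Matrix.zero_apply] <;> ring
  map_smul' r v := by
    ext (i | i) (j | j) <;>
      simp only [Matrix.fromBlocks_apply₁₁, Matrix.fromBlocks_apply₁₂, Matrix.fromBlocks_apply₂₁,
        Matrix.fromBlocks_apply₂₂, Matrix.smul_apply, Matrix.of_apply, Pi.smul_apply, smul_eq_mul,
        Matrix.zero_apply, mul_assoc, ← Finset.mul_sum, RingHom.id_apply, mul_zero]
    ring

theorem cubeMatrix_ratCast {d m : ℕ} (N' : Matrix (Fin d) (Fin d) ℚ)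
    (y : Fin d → ℚ) (a : ℕ) (E : Fin m → Fin d → ℚ) (w : Option (Fin m) → ℚ) :
    cubeMatrix ℝ N' y a E ((Algebra.linearMap ℚ ℝ).compLeft (Option (Fin m)) w) =
      (cubeMatrix ℚ N' y a E w).map (Rat.cast : ℚ → ℝ) := by
  ext (i | i) (j | j) <;> simp [cubeMatrix]

/-- The cone over a unit cube is mapped by `cubeMatrix` into the corresponding `σ(x, n)`. -/
theorem exists_mem_Gset_smul_eq_cubeMatrix {d m : ℕ} {γ' : (Matrix (Fin d) (Fin d) ℤ)ˣ}
    {L : Submodule ℤ (Fin d → ℚ)} {s : PmodQ d γ' →ₗ[ℚ] Psub d γ'} {E : Fin m → (Fin d → ℚ)}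
    (x : PmodQ d γ') (n : Fin m → ℤ) (b : Option (Fin m) → ℝ) (h0 : 0 ≤ b none)
    (hb : ∀ j, n j * b none ≤ b (some j) ∧ b (some j) ≤ (n j + 1) * b none) :
    ∃ G ∈ Gset d m γ' L s E x n,
      cubeMatrix ℝ (logMat d γ') (s x : Psub d γ') (aOrd d γ' L x) E b = b none • G := by
  have mem_Gset (c : Fin m → ℝ) (hc : ∀ j, (n j : ℝ) ≤ c j ∧ c j ≤ (n j : ℝ) + 1) :
      cubeMatrix ℝ (logMat d γ') (s x : Psub d γ') (aOrd d γ' L x) E (fun o => o.elim 1 c) ∈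
        Gset d m γ' L s E x n :=
    ⟨by rintro (j | j) <;> rfl, fun i j => by simp [cubeMatrix], c, hc,
      fun i => by simp [cubeMatrix]⟩
  rcases h0.eq_or_lt with h0 | h0
  · refine ⟨_, mem_Gset (fun j => n j) fun j => ⟨le_rfl, by linarith⟩, ?_⟩
    have hb0 : b = 0 := by
      ext (_ | j)
      · exact h0.symm
      · have := hb j
        rw [← h0, mul_zero, mul_zero] at this
        exact le_antisymm this.2 this.1
    rw [hb0, map_zero, Pi.zero_apply, zero_smul]
  · refine ⟨_, mem_Gset (fun j => b (some j) / b none) fun j => ?_, ?_⟩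
    · rw [le_div_iff₀ h0, div_le_iff₀ h0]
      exact hb j
    · rw [← map_smul]
      congr 1
      ext (_ | j)
      · simp
      · simp [mul_div_cancel₀ _ h0.ne']

open scoped NNReal in
theorem setOf_nonneg_combination_eq_span {V : Type*} [AddCommGroup V] [Module ℝ V] {t : ℕ}
    (f : Fin t → V) :
    {M : V | ∃ r : Fin t → ℝ, (∀ k, 0 ≤ r k) ∧ M = ∑ k, r k • f k} =
      Submodule.span ℝ≥0 (Set.range f) := by
  ext M
  rw [SetLike.mem_coe, Submodule.mem_span_range_iff_exists_fun]
  constructor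
  · rintro ⟨r, hr, rfl⟩
    exact ⟨fun k => ⟨r k, hr k⟩, rfl⟩
  · rintro ⟨c, rfl⟩
    exact ⟨fun k => c k, fun k => (c k).2, rfl⟩

/-- Every rational vector has a positive integral multiple in a lattice containing `ℤ^d`. -/
theorem exists_nsmul_mem_of_int_mem {d : ℕ} {L : Submodule ℤ (Fin d → ℚ)}
    (hLH : ∀ v : Fin d → ℤ, (fun i => (v i : ℚ)) ∈ L) (v : Fin d → ℚ) :
    ∃ b : ℕ, 0 < b ∧ b • v ∈ L := by
  refine ⟨∏ i, (v i).den, Finset.prod_pos fun i _ => (v i).den_pos, ?_⟩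
  have hdvd (i : Fin d) : ∃ c, ∏ i, (v i).den = (v i).den * c :=
    Finset.dvd_prod_of_mem _ (Finset.mem_univ i)
  choose c hc using hdvd
  convert hLH fun i => (c i : ℤ) * (v i).num using 1
  ext i
  rw [Pi.smul_apply, hc i, nsmul_eq_mul]
  push_cast
  rw [mul_right_comm, mul_comm ((v i).den : ℚ), Rat.mul_den_eq_num, mul_comm]

theorem aOrd_pos {d : ℕ} (γ' : (Matrix (Fin d) (Fin d) ℤ)ˣ) {L : Submodule ℤ (Fin d → ℚ)}
    (hLH : ∀ v : Fin d → ℤ, (fun i => (v i : ℚ)) ∈ L) (x : PmodQ d γ') :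
    0 < aOrd d γ' L x := by
  obtain ⟨p, rfl⟩ := (QinP d γ').mkQ_surjective x
  obtain ⟨b, hb, hbL⟩ := exists_nsmul_mem_of_int_mem hLH (p : Fin d → ℚ)
  exact (Nat.sInf_mem (s := {a : ℕ | 0 < a ∧ ∃ v : Psub d γ', (v : Fin d → ℚ) ∈ L ∧
    (QinP d γ').mkQ v = a • (QinP d γ').mkQ p}) ⟨b, hb, b • p, hbL, map_nsmul _ _ _⟩).1

/-- A `ℤ`-basis of `Q ∩ L` spans `Q` over `ℚ`. -/
theorem exists_eq_sum_of_mem_Qsub {d m : ℕ} {γ' : (Matrix (Fin d) (Fin d) ℤ)ˣ}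
    {L : Submodule ℤ (Fin d → ℚ)} (hLH : ∀ v : Fin d → ℤ, (fun i => (v i : ℚ)) ∈ L)
    {E : Fin m → (Fin d → ℚ)}
    (hEspan : Submodule.span ℤ (Set.range E) = (Qsub d γ').restrictScalars ℤ ⊓ L)
    {v : Fin d → ℚ} (hv : v ∈ Qsub d γ') : ∃ c : Fin m → ℚ, ∀ i, v i = ∑ j, c j * E j i := by
  obtain ⟨b, hb, hbL⟩ := exists_nsmul_mem_of_int_mem hLH v
  have hmem : b • v ∈ Submodule.span ℤ (Set.range E) := by
    rw [hEspan]
    exact ⟨(Qsub d γ').nsmul_mem hv b, hbL⟩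
  obtain ⟨c, hc⟩ := (Submodule.mem_span_range_iff_exists_fun ℤ).1 hmem
  refine ⟨fun j => c j / b, fun i => ?_⟩
  have hci := congrFun hc i
  simp only [Finset.sum_apply, Pi.smul_apply] at hci
  simp only [zsmul_eq_mul, nsmul_eq_mul] at hci
  have hb' : (b : ℚ) ≠ 0 := by positivity
  rw [← mul_right_inj' hb', ← hci, Finset.mul_sum]
  refine Finset.sum_congr rfl fun j _ => ?_
  field_simp

/-- An endomorphism of `H_ℚ` with image in `H'_ℚ`, restricting to `q N'` on `H'_ℚ` and having a
relative monodromy filtration, maps `e` into `q P`. -/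
theorem exists_mem_Psub_of_isRelMonodromyFil {d : ℕ} {γ' : (Matrix (Fin d) (Fin d) ℤ)ˣ}
    {N : Matrix (Idx d) (Idx d) ℚ} (hrow : ∀ j, N (Sum.inr ()) j = 0) {q : ℚ}
    (hres : ∀ i j : Fin d, N (Sum.inl i) (Sum.inl j) = q * logMat d γ' i j)
    {M : ℤ → Submodule ℝ (Idx d → ℝ)}
    (hM : IsRelMonodromyFil (Matrix.mulVecLin (N.map (Rat.cast : ℚ → ℝ))) (Wfil d) M) :
    ∃ w ∈ Psub d γ', ∀ i, N (Sum.inl i) (Sum.inr ()) = q * w i := by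
  obtain ⟨h, hh0, hh⟩ := hM.exists_mulVec_eq (by simp [hrow]) (Pi.single (Sum.inr ()) 1)
  obtain ⟨u, hu⟩ := exists_rat_mulVec_eq (q • logMat d γ')
    (fun i => N (Sum.inl i) (Sum.inr ())) (fun j => h (Sum.inl j)) (by
      ext i
      have hi := congrFun hh (Sum.inl i)
      simp only [Matrix.mulVec_single_one, Matrix.col_apply, Matrix.map_apply] at hi
      rw [hi]
      simp [Matrix.mulVec, dotProduct, hh0, hres])
  refine ⟨(logMat d γ').mulVec u, ⟨u, rfl⟩, fun i => ?_⟩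
  rw [← congrFun hu i, Matrix.smul_mulVec, Pi.smul_apply, smul_eq_mul]

open Pointwise in
/-- a sharp rational cone `σ` whose elements restrict on `H'` to nonnegative
multiples of `N'` and all admit relative monodromy filtrations can be finitely subdivided
into rational cones each contained in some `σ(x,n)`.
Here a ℚ-linear endomorphism of `H_ℚ` is encoded as a matrix acting by `mulVec`, and the
cone generated by real matrices `A_k` is `{Σ r_k • A_k | r_k ≥ 0}`. -/
theorem stmt3
    (d m : ℕ) (γ' : (Matrix (Fin d) (Fin d) ℤ)ˣ)
    -- `γ' - 1` is nilpotent
    (hγ' : IsNilpotent ((γ' : Matrix (Fin d) (Fin d) ℤ) - 1))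
    -- `L`: a finitely generated ℤ-submodule of `H'_ℚ` containing `H' + N'(H')`
    (L : Submodule ℤ (Fin d → ℚ)) (hLfg : L.FG)
    (hLH : ∀ v : Fin d → ℤ, (fun i => (v i : ℚ)) ∈ L)
    (hLN : ∀ v : Fin d → ℤ, (logMat d γ').mulVec (fun i => (v i : ℚ)) ∈ L)
    -- `s`: the ℚ-linear map `P/Q → P` induced by a ℤ-linear section of
    -- `P∩L → (P∩L)/(Q∩L)`; equivalently, a ℚ-linear section of `P → P/Q`
    -- mapping classes of elements of `P∩L` into `L`
    (s : PmodQ d γ' →ₗ[ℚ] Psub d γ')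
    (hs : ∀ x : PmodQ d γ', (QinP d γ').mkQ (s x) = x)
    (hsL : ∀ v : Psub d γ', (v : Fin d → ℚ) ∈ L →
      ((s ((QinP d γ').mkQ v) : Psub d γ') : Fin d → ℚ) ∈ L)
    -- `(e_j)`: a ℤ-basis of `Q ∩ L`
    (E : Fin m → (Fin d → ℚ))
    (hEind : LinearIndependent ℤ E)
    (hEspan : Submodule.span ℤ (Set.range E) = (Qsub d γ').restrictScalars ℤ ⊓ L)
    -- mutually commuting ℚ-linear maps `N₁, …, N_t` on `H_ℚ`
    (t : ℕ) (Nq : Fin t → Matrix (Idx d) (Idx d) ℚ)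
    (hcomm : ∀ k l, Nq k * Nq l = Nq l * Nq k)
    -- `N_k(H_ℚ) ⊆ H'_ℚ`
    (hrow : ∀ k, ∀ j, Nq k (Sum.inr ()) j = 0)
    -- the restriction of `N_k` to `H'_ℚ` is a nonnegative rational multiple of `N'`
    (hres : ∀ k, ∃ q : ℚ, 0 ≤ q ∧
      ∀ i j : Fin d, Nq k (Sum.inl i) (Sum.inl j) = q * logMat d γ' i j)
    -- `σ ∩ (-σ) = {0}`
    (hsharp :
      {M : Matrix (Idx d) (Idx d) ℝ | ∃ r : Fin t → ℝ,
          (∀ k, 0 ≤ r k) ∧ M = ∑ k, r k • (Nq k).map (Rat.cast : ℚ → ℝ)} ∩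
        -{M : Matrix (Idx d) (Idx d) ℝ | ∃ r : Fin t → ℝ,
          (∀ k, 0 ≤ r k) ∧ M = ∑ k, r k • (Nq k).map (Rat.cast : ℚ → ℝ)} = {0})
    -- every `N ∈ σ` admits a relative monodromy filtration `M(N, W)`
    (hadm : ∀ N ∈ {M : Matrix (Idx d) (Idx d) ℝ | ∃ r : Fin t → ℝ,
          (∀ k, 0 ≤ r k) ∧ M = ∑ k, r k • (Nq k).map (Rat.cast : ℚ → ℝ)},
      ∃ M : ℤ → Submodule ℝ (Idx d → ℝ),
        IsRelMonodromyFil (Matrix.mulVecLin N) (Wfil d) M) :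
    ∃ (u : ℕ) (T : Fin u → Set (Matrix (Idx d) (Idx d) ℝ)),
      -- each `σ_i` is the cone generated by finitely many ℝ-linear extensions of
      -- ℚ-linear endomorphisms of `H_ℚ`
      (∀ i, ∃ (t' : ℕ) (gq : Fin t' → Matrix (Idx d) (Idx d) ℚ),
        T i = {M : Matrix (Idx d) (Idx d) ℝ | ∃ r : Fin t' → ℝ,
          (∀ k, 0 ≤ r k) ∧ M = ∑ k, r k • (gq k).map (Rat.cast : ℚ → ℝ)}) ∧
      -- `σ = σ₁ ∪ ⋯ ∪ σ_u`
      {M : Matrix (Idx d) (Idx d) ℝ | ∃ r : Fin t → ℝ,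
          (∀ k, 0 ≤ r k) ∧ M = ∑ k, r k • (Nq k).map (Rat.cast : ℚ → ℝ)} = ⋃ i, T i ∧
      -- each `σ_i` is contained in some `σ(x,n)`
      ∀ i, ∃ (x : PmodQ d γ') (n : Fin m → ℤ), T i ⊆ sigmaCone d m γ' L s E x n := by
  classical
  have hadmq (k : Fin t) : ∃ M : ℤ → Submodule ℝ (Idx d → ℝ),
      IsRelMonodromyFil (Matrix.mulVecLin ((Nq k).map (Rat.cast : ℚ → ℝ))) (Wfil d) M := by
    refine hadm _ ⟨Pi.single k 1, fun l => ?_, ?_⟩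
    · by_cases h : l = k
      · subst h; simp
      · simp [h]
    · simp [Pi.single_apply]
  choose q hq0 hq using hres
  have hw (k : Fin t) : ∃ w ∈ Psub d γ', ∀ i, Nq k (Sum.inl i) (Sum.inr ()) = q k * w i := by
    obtain ⟨M, hM⟩ := hadmq k
    exact exists_mem_Psub_of_isRelMonodromyFil (hrow k) (hq k) hM
  choose w hwP hw using hw
  have hww (k l : Fin t) (hk : q k ≠ 0) (hl : q l ≠ 0) :
      (logMat d γ').mulVec (w k) = (logMat d γ').mulVec (w l) := by
    ext i
    have h := congrFun (congrFun (hcomm k l) (Sum.inl i)) (Sum.inr ())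
    simp only [Matrix.mul_apply, Fintype.sum_sum_type, hq, hw, hrow, mul_zero,
      Finset.sum_const_zero, add_zero] at h
    have hfac (a b : ℚ) (u : Fin d → ℚ) : ∑ j, a * logMat d γ' i j * (b * u j) =
        a * b * (logMat d γ').mulVec u i := by
      simp only [Matrix.mulVec, dotProduct, Finset.mul_sum]
      exact Finset.sum_congr rfl fun j _ => by ring
    rw [hfac, hfac, mul_comm (q l)] at h
    exact (mul_left_cancel₀ (mul_ne_zero hk hl) h).symm
  obtain ⟨x, hx⟩ : ∃ x : PmodQ d γ', ∀ k, q k ≠ 0 → (QinP d γ').mkQ ⟨w k, hwP k⟩ = x := by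
    by_cases h : ∃ l, q l ≠ 0
    · obtain ⟨l, hl⟩ := h
      refine ⟨(QinP d γ').mkQ ⟨w l, hwP l⟩, fun k hk => ?_⟩
      rw [← sub_eq_zero, ← map_sub, Submodule.mkQ_apply, Submodule.Quotient.mk_eq_zero]
      refine ⟨?_, (Psub d γ').sub_mem (hwP k) (hwP l)⟩
      change (logMat d γ').mulVec (w k - w l) = 0
      rw [Matrix.mulVec_sub, hww k l hk hl, sub_self]
    · push Not at h
      exact ⟨0, fun k hk => absurd (h k) hk⟩
  have ha : (aOrd d γ' L x : ℚ) ≠ 0 := by exact_mod_cast (aOrd_pos γ' hLH x).ne'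
  have hc (k : Fin t) : ∃ c : Option (Fin m) → ℚ, c none = q k ∧ (q k = 0 → c = 0) ∧
      cubeMatrix ℚ (logMat d γ') (s x : Psub d γ') (aOrd d γ' L x) E c = Nq k := by
    by_cases hk : q k = 0
    · refine ⟨0, hk.symm, fun _ => rfl, ?_⟩
      rw [map_zero]
      ext (i | i) (j | j) <;> simp [hq, hw, hrow, hk]
    · have hmem : w k - s x ∈ Qsub d γ' := by
        have h : (QinP d γ').mkQ (⟨w k, hwP k⟩ - s x) = 0 := by rw [map_sub, hs, hx k hk, sub_self]
        rw [Submodule.mkQ_apply, Submodule.Quotient.mk_eq_zero] at h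
        exact h
      obtain ⟨c, hc⟩ := exists_eq_sum_of_mem_Qsub hLH hEspan hmem
      refine ⟨fun o => o.elim (q k) fun j => aOrd d γ' L x * (q k * c j), rfl,
        fun h => absurd h hk, ?_⟩
      ext (i | i) (j | j)
      · simp [cubeMatrix, hq]
      · have hci := hc i
        simp only [cubeMatrix, LinearMap.coe_mk, AddHom.coe_mk, Matrix.fromBlocks_apply₁₂,
          Matrix.of_apply, Option.elim, Rat.cast_id, hw, mul_assoc, ← Finset.mul_sum, ← hci,
          inv_mul_cancel_left₀ ha, Pi.sub_apply]
        ring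
      · simp [cubeMatrix, hrow]
      · simp [cubeMatrix, hrow]
  choose c hcq hc0 hc using hc
  obtain ⟨K, hK0, hK⟩ : ∃ K : ℕ, 0 < K ∧ ∀ k j, |c k (some j)| ≤ K * c k none := by
    have hex (p : Fin t × Fin m) : ∃ K : ℕ, |c p.1 (some p.2)| ≤ K * c p.1 none := by
      by_cases hk : q p.1 = 0
      · exact ⟨0, by simp [hc0 _ hk]⟩
      · have hpos : 0 < c p.1 none := by
          rw [hcq]
          exact lt_of_le_of_ne (hq0 _) (Ne.symm hk)
        obtain ⟨K, hK⟩ := exists_nat_ge (|c p.1 (some p.2)| / c p.1 none)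
        exact ⟨K, (div_le_iff₀ hpos).1 hK⟩
    choose K hK using hex
    refine ⟨Finset.univ.sup K + 1, Nat.succ_pos _, fun k j => (hK (k, j)).trans ?_⟩
    refine mul_le_mul_of_nonneg_right ?_ (by rw [hcq]; exact hq0 k)
    exact_mod_cast (Finset.le_sup (Finset.mem_univ (k, j))).trans (Nat.le_succ _)
  set ι := (Algebra.linearMap ℚ ℝ).compLeft (Option (Fin m)) with hι
  set Φ := cubeMatrix ℝ (logMat d γ') (s x : Psub d γ') (aOrd d γ' L x) E with hΦ
  have hspan {n : ℕ} (f : Fin n → Option (Fin m) → ℝ) :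
      {M | ∃ r : Fin n → ℝ, (∀ k, 0 ≤ r k) ∧ M = ∑ k, r k • Φ (f k)} =
        Φ '' (Submodule.span NNReal (Set.range f)) := by
    rw [← setOf_nonneg_combination_eq_span]
    ext M
    constructor
    · rintro ⟨r, hr, rfl⟩
      exact ⟨_, ⟨r, hr, rfl⟩, by simp⟩
    · rintro ⟨_, ⟨r, hr, rfl⟩, rfl⟩
      exact ⟨r, hr, by simp⟩
  have hσ : {M : Matrix (Idx d) (Idx d) ℝ | ∃ r : Fin t → ℝ,
      (∀ k, 0 ≤ r k) ∧ M = ∑ k, r k • (Nq k).map (Rat.cast : ℚ → ℝ)} =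
      Φ '' (Submodule.span NNReal (Set.range fun k => ι (c k))) := by
    rw [← hspan]
    simp only [hΦ, hι, cubeMatrix_ratCast, hc]
  obtain ⟨𝓑, h𝓑fin, h𝓑, h𝓑c⟩ := exists_finite_cube_subdivision (Set.range fun k => ι (c k))
    (Set.finite_range _) (by rintro _ ⟨k, rfl⟩; exact ⟨c k, rfl⟩) K hK0
    (by
      rintro _ ⟨k, rfl⟩
      have : 0 ≤ c k none := by rw [hcq]; exact hq0 k
      simpa [hι] using this)
    (by
      rintro _ ⟨k, rfl⟩ j
      simpa [hι] using (Rat.cast_le (K := ℝ)).2 (hK k j))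
  obtain ⟨u, B, -, hB⟩ := h𝓑fin.fin_param
  have hBmem (i : Fin u) : B i ∈ 𝓑 := hB ▸ Set.mem_range_self i
  have hparam (i : Fin u) : ∃ (n : ℕ) (f : Fin n → Option (Fin m) → ℚ),
      B i = Set.range fun k => ι (f k) := by
    obtain ⟨hfin, hR, -, -⟩ := h𝓑 _ (hBmem i)
    obtain ⟨n, f, -, hf⟩ := hfin.fin_param
    have hfR (k : Fin n) : ∃ v, ι v = f k := hR (hf ▸ Set.mem_range_self k)
    choose g hg using hfR
    exact ⟨n, g, by simp only [hg]; exact hf.symm⟩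
  refine ⟨u, fun i => Φ '' (Submodule.span NNReal (B i)), fun i => ?_, ?_, fun i => ?_⟩
  · obtain ⟨n, f, hf⟩ := hparam i
    refine ⟨n, fun k => cubeMatrix ℚ (logMat d γ') (s x : Psub d γ') (aOrd d γ' L x) E (f k), ?_⟩
    simp only [hf, ← hspan]
    simp only [hΦ, hι, cubeMatrix_ratCast]
  · rw [hσ, ← Set.image_iUnion]
    congr 1
    ext v
    rw [Set.mem_iUnion]
    constructor
    · intro hv
      obtain ⟨D, hD, hvD⟩ := h𝓑c v hv
      rw [← hB] at hD
      obtain ⟨i, rfl⟩ := hD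
      exact ⟨i, hvD⟩
    · rintro ⟨i, hv⟩
      exact Submodule.span_le.2 (h𝓑 _ (hBmem i)).2.2.1 hv
  · obtain ⟨-, -, -, n, hn⟩ := h𝓑 _ (hBmem i)
    obtain ⟨t', f, hf⟩ := hparam i
    refine ⟨x, n, ?_⟩
    simp only [hf, ← hspan]
    rintro _ ⟨r, hr, rfl⟩
    have hfB (k : Fin t') : ι (f k) ∈ B i := hf ▸ Set.mem_range_self k
    have hG (k : Fin t') := exists_mem_Gset_smul_eq_cubeMatrix (L := L) (s := s) (E := E) x n
      (ι (f k)) (hn _ (hfB k)).1 (hn _ (hfB k)).2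
    choose G hG hGeq using hG
    refine ⟨t', G, fun k => r k * ι (f k) none, hG,
      fun k => mul_nonneg (hr k) (hn _ (hfB k)).1, ?_⟩
    exact Finset.sum_congr rfl fun k _ => by rw [mul_smul, ← hGeq]
end

section
/- For every x ∈ P/Q, every n ∈ ℤ^m, and every N ∈ σ(x,n), one has N(W_j) ⊆ W_j for all j, and there exists a relative monodromy filtration M(N,W). -/
open Matrix

/-- The monodromy filtration (centred at `0`) of the restriction of `N` to a stable subspace `A`,
given by the explicit formula `M_l = Σ_i Ker N^{i+1} ∩ N^{i-l} A` inside `A`. -/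
def monodromyFil {K V : Type*} [Field K] [AddCommGroup V] [Module K V]
    (N : V →ₗ[K] V) (A : Submodule K V) (l : ℤ) : Submodule K V :=
  ⨆ i : ℕ, A ⊓ LinearMap.ker (N ^ (i + 1)) ⊓ A.map (N ^ ((i : ℤ) - l).toNat)

section MonodromyFil

variable {K V : Type*} [Field K] [AddCommGroup V] [Module K V] {N : V →ₗ[K] V}
  {A : Submodule K V}

theorem pow_apply_mem_of_map_le (hA : A.map N ≤ A) (k : ℕ) {v : V} (hv : v ∈ A) :
    (N ^ k) v ∈ A := by
  induction k with
  | zero => simpa using hv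
  | succ k ih =>
    rw [pow_succ', Module.End.mul_apply]
    exact hA ⟨_, ih, rfl⟩

theorem map_pow_antitone (hA : A.map N ≤ A) {a b : ℕ} (h : a ≤ b) :
    A.map (N ^ b) ≤ A.map (N ^ a) := by
  rintro _ ⟨v, hv, rfl⟩
  refine ⟨(N ^ (b - a)) v, pow_apply_mem_of_map_le hA _ hv, ?_⟩
  rw [← Module.End.mul_apply, ← pow_add, Nat.add_sub_cancel' h]

theorem mem_monodromyFil_of_mem {l : ℤ} {v : V} (i : ℕ) (hA : v ∈ A) (hk : (N ^ (i + 1)) v = 0)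
    (hi : v ∈ A.map (N ^ ((i : ℤ) - l).toNat)) : v ∈ monodromyFil N A l :=
  Submodule.mem_iSup_of_mem i ⟨⟨hA, hk⟩, hi⟩

theorem monodromyFil_le (l : ℤ) : monodromyFil N A l ≤ A :=
  iSup_le fun _ _ hv => hv.1.1

theorem monodromyFil_mono (hA : A.map N ≤ A) : Monotone (monodromyFil N A) := fun a b h =>
  iSup_mono fun i => inf_le_inf_left _ (map_pow_antitone hA (Int.toNat_le_toNat (by lia)))

theorem map_monodromyFil_le (hA : A.map N ≤ A) (l : ℤ) :
    (monodromyFil N A l).map N ≤ monodromyFil N A (l - 2) := by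
  rw [Submodule.map_le_iff_le_comap]
  refine iSup_le ?_
  rintro i v ⟨⟨hv, hk⟩, u, hu, rfl⟩
  have hk' : (N ^ (i + 1)) ((N ^ ((i : ℤ) - l).toNat) u) = 0 := hk
  rw [Submodule.mem_comap]
  cases i with
  | zero =>
    have h0 : N ((N ^ (((0 : ℕ) : ℤ) - l).toNat) u) = 0 := by simpa using hk'
    rw [h0]
    exact zero_mem _
  | succ i =>
    refine mem_monodromyFil_of_mem i (hA ⟨_, hv, rfl⟩) ?_ ?_
    · rw [← Module.End.mul_apply, ← pow_succ]
      exact hk'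
    · rw [← Module.End.mul_apply, ← pow_succ']
      exact map_pow_antitone hA (by lia) ⟨u, hu, rfl⟩

theorem monodromyFil_neg_le_map (hA : A.map N ≤ A) (l : ℕ) :
    monodromyFil N A (-l) ≤ (monodromyFil N A l).map (N ^ l) := by
  refine iSup_le ?_
  rintro i v ⟨⟨hv, hk⟩, u, hu, rfl⟩
  have e1 : ((i : ℤ) - -(l : ℤ)).toNat = l + i := by lia
  rw [e1] at hk ⊢
  refine ⟨(N ^ i) u, ?_, ?_⟩
  · refine mem_monodromyFil_of_mem (i + l) (pow_apply_mem_of_map_le hA _ hu) ?_ ?_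
    · have hk' : (N ^ (i + 1)) ((N ^ (l + i)) u) = 0 := hk
      rw [← Module.End.mul_apply, ← pow_add] at hk' ⊢
      rw [← hk']
      congr 2
      ring
    · have e2 : (((i + l : ℕ) : ℤ) - (l : ℤ)).toNat = i := by lia
      rw [e2]
      exact ⟨u, hu, rfl⟩
  · rw [← Module.End.mul_apply, ← pow_add]

theorem mem_monodromyFil_of_pow_apply_mem (hA : A.map N ≤ A) (l : ℕ) {v : V} (hv : v ∈ A)
    (h : (N ^ l) v ∈ monodromyFil N A (-l - 1)) : v ∈ monodromyFil N A (l - 1) := by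
  have e1 : (-(l : ℤ) - 1) = -((l + 1 : ℕ) : ℤ) := by lia
  rw [e1] at h
  obtain ⟨y, hy, hyv⟩ := monodromyFil_neg_le_map hA (l + 1) h
  have hNy : N y ∈ monodromyFil N A (l - 1) := by
    have := map_monodromyFil_le hA _ ⟨y, hy, rfl⟩
    convert this using 2
    lia
  have hker : (N ^ l) (v - N y) = 0 := by
    rw [map_sub, ← hyv, pow_succ, Module.End.mul_apply, sub_self]
  have hsub : v - N y ∈ monodromyFil N A (l - 1) := by
    cases l with
    | zero =>
      have h0 : v - N y = 0 := by simpa using hker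
      rw [h0]
      exact zero_mem _
    | succ l =>
      have hmem : v - N y ∈ A := sub_mem hv (monodromyFil_le _ hNy)
      refine mem_monodromyFil_of_mem l hmem hker ?_
      have e2 : ((l : ℤ) - (((l + 1 : ℕ) : ℤ) - 1)).toNat = 0 := by lia
      rw [e2]
      exact ⟨_, hmem, rfl⟩
  simpa using add_mem hsub hNy

theorem monodromyFil_eq_bot {n : ℕ} (hA : A.map N ≤ A) (hn : ∀ v ∈ A, (N ^ n) v = 0) {l : ℤ}
    (hl : l ≤ -n) : monodromyFil N A l = ⊥ := by
  refine iSup_eq_bot.2 fun i => eq_bot_iff.2 ?_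
  rintro v ⟨-, hv⟩
  obtain ⟨u, hu, rfl⟩ := map_pow_antitone (b := ((i : ℤ) - l).toNat) (a := n) hA (by lia) hv
  exact hn u hu

theorem monodromyFil_eq_self {n : ℕ} (hn : ∀ v ∈ A, (N ^ n) v = 0) {l : ℤ}
    (hl : n ≤ l) : monodromyFil N A l = A := by
  refine le_antisymm (monodromyFil_le _) fun v hv => ?_
  refine mem_monodromyFil_of_mem n hv ?_ ?_
  · rw [pow_succ', Module.End.mul_apply, hn v hv, map_zero]
  · have e2 : ((n : ℤ) - l).toNat = 0 := by lia
    rw [e2]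
    exact ⟨v, hv, rfl⟩

/-- If `V = A ⊕ K e` with `N` nilpotent on the stable subspace `A` and `N e = 0`, then `N` admits
a relative monodromy filtration with respect to the filtration with `W_j = V` for `j ≥ 0`,
`W_{-1} = A` and `W_j = 0` for `j ≤ -2`. -/
theorem exists_isRelMonodromyFil_of_isCompl {n : ℕ} {e : V} (hA : A.map N ≤ A)
    (hn : ∀ v ∈ A, (N ^ n) v = 0) (he : N e = 0) (hAe : IsCompl A (Submodule.span K {e})) :
    ∃ M, IsRelMonodromyFil N
      (fun j : ℤ => if 0 ≤ j then ⊤ else if j = -1 then A else ⊥) M := by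
  set S : Submodule K V := Submodule.span K {e} with hS
  set M : ℤ → Submodule K V := fun j => monodromyFil N A (j + 1) ⊔ if 0 ≤ j then S else ⊥ with hM
  have hNS : S.map N = ⊥ := by
    rw [hS, Submodule.map_span, Set.image_singleton, he, Submodule.span_zero_singleton]
  have hMneg : ∀ j < 0, M j = monodromyFil N A (j + 1) := fun j hj => by
    simp [hM, not_le.2 hj]
  have hMA : ∀ j, M j ⊓ A = monodromyFil N A (j + 1) := fun j => by
    by_cases hj : 0 ≤ j
    · simp only [hM, if_pos hj]
      rw [sup_inf_assoc_of_le S (monodromyFil_le (j + 1)), inf_comm S A, hAe.inf_eq_bot,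
        sup_bot_eq]
    · rw [hMneg j (not_le.1 hj)]
      exact inf_eq_left.2 (monodromyFil_le _)
  refine ⟨M, ?_, ⟨-n - 1, ?_⟩, ⟨n, ?_⟩, ?_, ?_⟩
  · intro a b hab
    refine sup_le_sup (monodromyFil_mono hA (by lia)) ?_
    split_ifs
    · exact le_rfl
    · lia
    · exact bot_le
    · exact le_rfl
  · intro j hj
    rw [hMneg j (by lia)]
    exact monodromyFil_eq_bot hA hn (by lia)
  · intro j hj
    have h0 : 0 ≤ j := by lia
    simp only [hM, if_pos h0]
    rw [monodromyFil_eq_self hn (by lia), hAe.sup_eq_top]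
  · intro j
    have h1 : (if 0 ≤ j then S else ⊥).map N = ⊥ := by
      split_ifs
      · exact hNS
      · exact Submodule.map_bot _
    simp only [hM]
    rw [Submodule.map_sup, h1, sup_bot_eq]
    refine le_sup_of_le_left ((map_monodromyFil_le hA _).trans (le_of_eq ?_))
    congr 1
    ring
  · intro j l
    rcases lt_trichotomy j (-1) with hj | rfl | hj
    · have h0 : ¬ 0 ≤ j := by lia
      have h1 : ¬ j = -1 := by lia
      simp only [if_neg h0, if_neg h1, inf_bot_eq, bot_inf_eq, bot_le, and_self]
    · have h0 : ¬ (0 : ℤ) ≤ -1 := by lia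
      have h1 : ¬ (0 : ℤ) ≤ -1 - 1 := by lia
      have h2 : ¬ (-1 - 1 : ℤ) = -1 := by lia
      simp only [if_neg h0, if_neg h1, if_neg h2, if_true, sup_bot_eq, hMA]
      have e1 : (-1 - (l : ℤ) + 1) = -l := by ring
      have e2 : (-1 + (l : ℤ) + 1) = l := by ring
      have e3 : (-1 - (l : ℤ) - 1 + 1) = -l - 1 := by ring
      have e4 : (-1 + (l : ℤ) - 1 + 1) = l - 1 := by ring
      rw [e1, e2, e3, e4]
      refine ⟨le_sup_of_le_left (monodromyFil_neg_le_map hA l), ?_⟩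
      rintro v ⟨hv, hv'⟩
      exact mem_monodromyFil_of_pow_apply_mem hA l (monodromyFil_le _ hv) hv'
    · rcases eq_or_lt_of_le (show 0 ≤ j by lia) with rfl | hj'
      · have h0 : ¬ (0 : ℤ) ≤ 0 - 1 := by lia
        have h1 : (0 - 1 : ℤ) = -1 := by lia
        simp only [if_neg h0, if_pos h1, le_refl, if_true, inf_top_eq]
        have hMle : ∀ j < 0, M j ≤ A := fun j hj => by
          rw [hMneg j hj]
          exact monodromyFil_le _
        rcases Nat.eq_zero_or_pos l with rfl | hl
        · constructor
          · refine le_sup_of_le_left (le_sup_of_le_left ?_)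
            intro v hv
            exact ⟨v, by simpa using hv, by simp⟩
          · rintro v ⟨-, hv⟩
            rw [SetLike.mem_coe, Submodule.mem_comap, sup_eq_right.2 (hMle _ (by lia))] at hv
            exact Submodule.mem_sup_right (by simpa using hv)
        · refine ⟨le_sup_of_le_right (hMle _ (by lia)), le_of_le_of_eq le_top ?_⟩
          have h3 : 0 ≤ 0 + (l : ℤ) - 1 := by lia
          rw [eq_comm, eq_top_iff, ← hAe.sup_eq_top]
          refine sup_le le_sup_right (le_sup_of_le_left ?_)
          simp only [hM, if_pos h3]
          exact le_sup_right
      · have h0 : 0 ≤ j := by lia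
        have h1 : 0 ≤ j - 1 := by lia
        simp only [if_pos h0, if_pos h1, sup_top_eq, le_top, and_self]

end MonodromyFil

theorem isNilpotent_logMat {d : ℕ} {γ' : (Matrix (Fin d) (Fin d) ℤ)ˣ}
    (hγ' : IsNilpotent ((γ' : Matrix (Fin d) (Fin d) ℤ) - 1)) : IsNilpotent (logMat d γ') := by
  have h : IsNilpotent ((γ' : Matrix (Fin d) (Fin d) ℤ).map (Int.cast : ℤ → ℚ) - 1) := by
    have := hγ'.map (Int.castRingHom ℚ).mapMatrix
    rwa [map_sub, map_one] at this
  refine Commute.isNilpotent_sum (fun i hi => ?_) fun i j _ _ => ?_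
  · exact (h.pow_of_pos (by have := Finset.mem_Icc.1 hi; lia)).smul _
  · exact (((Commute.refl _).pow_pow i j).smul_left _).smul_right _

theorem cast_mem_range_of_mem_Psub {d : ℕ} {γ' : (Matrix (Fin d) (Fin d) ℤ)ˣ} {v : Fin d → ℚ}
    (hv : v ∈ Psub d γ') :
    (fun i => (v i : ℝ)) ∈ LinearMap.range ((logMat d γ').map (Rat.cast : ℚ → ℝ)).mulVecLin := by
  obtain ⟨u, rfl⟩ := hv
  refine ⟨fun i => (u i : ℝ), ?_⟩
  ext i
  simp [Matrix.mulVec, dotProduct]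

/-- Elements of `σ(x,n)` have vanishing last row, restrict to a multiple `r N'` of `N'` on `H'_ℝ`,
and send `e` into the image of `r N'`. -/
theorem exists_block_form_of_mem_sigmaCone {d m : ℕ} {γ' : (Matrix (Fin d) (Fin d) ℤ)ˣ}
    {L : Submodule ℤ (Fin d → ℚ)} {s : PmodQ d γ' →ₗ[ℚ] Psub d γ'} {E : Fin m → (Fin d → ℚ)}
    (hE : ∀ j, E j ∈ Psub d γ') {x : PmodQ d γ'} {n : Fin m → ℤ}
    {N : Matrix (Idx d) (Idx d) ℝ} (hN : N ∈ sigmaCone d m γ' L s E x n) :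
    (∀ j, N (Sum.inr ()) j = 0) ∧ ∃ r : ℝ,
      (∀ i j : Fin d, N (Sum.inl i) (Sum.inl j) = r * (logMat d γ' i j : ℝ)) ∧
      ∃ h : Fin d → ℝ, ∀ i, N (Sum.inl i) (Sum.inr ()) =
        ∑ j, N (Sum.inl i) (Sum.inl j) * h j := by
  obtain ⟨t, f, r, hf, hr, rfl⟩ := hN
  have hblock : ∀ i j : Fin d, (∑ k, r k • f k) (Sum.inl i) (Sum.inl j) =
      (∑ k, r k) * (logMat d γ' i j : ℝ) := fun i j => by
    rw [Matrix.sum_apply, Finset.sum_mul]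
    exact Finset.sum_congr rfl fun k _ => by rw [Matrix.smul_apply, smul_eq_mul, (hf k).2.1]
  refine ⟨fun j => ?_, ∑ k, r k, hblock, ?_⟩
  · rw [Matrix.sum_apply]
    exact Finset.sum_eq_zero fun k _ => by rw [Matrix.smul_apply, (hf k).1, smul_zero]
  rcases eq_or_ne (∑ k, r k) 0 with h0 | h0
  · have hr0 := (Finset.sum_eq_zero_iff_of_nonneg fun k _ => hr k).1 h0
    have hz : ∑ k, r k • f k = 0 := Finset.sum_eq_zero fun k hk => by rw [hr0 k hk, zero_smul]
    exact ⟨0, fun i => by simp [hz]⟩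
  · have hmem : (fun i => (∑ k, r k • f k) (Sum.inl i) (Sum.inr ())) ∈
        LinearMap.range ((logMat d γ').map (Rat.cast : ℚ → ℝ)).mulVecLin := by
      have hfk : ∀ k, (fun i => f k (Sum.inl i) (Sum.inr ())) ∈
          LinearMap.range ((logMat d γ').map (Rat.cast : ℚ → ℝ)).mulVecLin := fun k => by
        obtain ⟨-, -, c, -, hc⟩ := hf k
        convert add_mem (cast_mem_range_of_mem_Psub (s x).2)
          (Submodule.smul_mem _ ((aOrd d γ' L x : ℝ))⁻¹
            (Submodule.sum_mem _ fun j (_ : j ∈ Finset.univ) =>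
              Submodule.smul_mem _ (c j) (cast_mem_range_of_mem_Psub (hE j)))) using 1
        ext i
        simp [hc]
      convert Submodule.sum_mem _ fun k (_ : k ∈ Finset.univ) =>
        Submodule.smul_mem _ (r k) (hfk k) using 1
      ext i
      simp [Matrix.sum_apply]
    obtain ⟨h, hh⟩ := hmem
    refine ⟨(∑ k, r k)⁻¹ • h, fun i => ?_⟩
    rw [← congrFun hh i]
    simp only [hblock, Matrix.mulVecLin_apply, Matrix.mulVec, dotProduct, Matrix.map_apply,
      Pi.smul_apply, smul_eq_mul]
    refine Finset.sum_congr rfl fun j _ => ?_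
    field_simp

/-- every `N ∈ σ(x,n)` preserves the weight filtration `W` and admits a
relative monodromy filtration `M(N, W)`. -/
theorem stmt4
    (d m : ℕ) (γ' : (Matrix (Fin d) (Fin d) ℤ)ˣ)
    -- `γ' - 1` is nilpotent
    (hγ' : IsNilpotent ((γ' : Matrix (Fin d) (Fin d) ℤ) - 1))
    -- `L`: a finitely generated ℤ-submodule of `H'_ℚ` containing `H' + N'(H')`
    (L : Submodule ℤ (Fin d → ℚ)) (hLfg : L.FG)
    (hLH : ∀ v : Fin d → ℤ, (fun i => (v i : ℚ)) ∈ L)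
    (hLN : ∀ v : Fin d → ℤ, (logMat d γ').mulVec (fun i => (v i : ℚ)) ∈ L)
    -- `s`: the ℚ-linear map `P/Q → P` induced by a ℤ-linear section of
    -- `P∩L → (P∩L)/(Q∩L)`; equivalently, a ℚ-linear section of `P → P/Q`
    -- mapping classes of elements of `P∩L` into `L`
    (s : PmodQ d γ' →ₗ[ℚ] Psub d γ')
    (hs : ∀ x : PmodQ d γ', (QinP d γ').mkQ (s x) = x)
    (hsL : ∀ v : Psub d γ', (v : Fin d → ℚ) ∈ L →
      ((s ((QinP d γ').mkQ v) : Psub d γ') : Fin d → ℚ) ∈ L)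
    -- `(e_j)`: a ℤ-basis of `Q ∩ L`
    (E : Fin m → (Fin d → ℚ))
    (hEind : LinearIndependent ℤ E)
    (hEspan : Submodule.span ℤ (Set.range E) = (Qsub d γ').restrictScalars ℤ ⊓ L)
    (x : PmodQ d γ') (n : Fin m → ℤ) :
    ∀ N ∈ sigmaCone d m γ' L s E x n,
      (∀ j : ℤ, (Wfil d j).map N.mulVecLin ≤ Wfil d j) ∧
      ∃ M : ℤ → Submodule ℝ (Idx d → ℝ), IsRelMonodromyFil N.mulVecLin (Wfil d) M := by
  intro N hN
  have hE : ∀ j, E j ∈ Psub d γ' := fun j => by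
    have hj : E j ∈ (Qsub d γ').restrictScalars ℤ ⊓ L :=
      hEspan ▸ Submodule.subset_span ⟨j, rfl⟩
    exact hj.1.2
  obtain ⟨hrow, r, hblock, h, hcol⟩ := exists_block_form_of_mem_sigmaCone hE hN
  set A : Submodule ℝ (Idx d → ℝ) :=
    LinearMap.ker (LinearMap.proj (Sum.inr ()) : ((_ : Idx d) → ℝ) →ₗ[ℝ] ℝ) with hAdef
  have hmemA : ∀ v : Idx d → ℝ, v ∈ A ↔ v (Sum.inr ()) = 0 := fun v => by simp [hAdef]
  have hNA : ∀ v, N.mulVecLin v ∈ A := fun v => by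
    simp [hmemA, Matrix.mulVec, dotProduct, hrow]
  have hAN : A.map N.mulVecLin ≤ A := Submodule.map_le_iff_le_comap.2 fun w _ => hNA w
  refine ⟨fun j => ?_, ?_⟩
  · rintro _ ⟨v, hv, rfl⟩
    simp only [Wfil, ← hAdef] at hv ⊢
    split_ifs at hv ⊢
    · trivial
    · exact hNA v
    · rw [(Submodule.mem_bot ℝ).1 hv, map_zero]
      exact zero_mem _
  obtain ⟨p, hp⟩ := isNilpotent_logMat hγ'
  have hpow : ∀ (k : ℕ) (v : Idx d → ℝ), v ∈ A → ∀ i, (N.mulVecLin ^ k) v (Sum.inl i) =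
      r ^ k * ∑ j, ((logMat d γ' ^ k) i j : ℝ) * v (Sum.inl j) := by
    intro k
    induction k with
    | zero =>
      intro v _ i
      simp [Matrix.one_apply, apply_ite (Rat.cast : ℚ → ℝ)]
    | succ k ih =>
      intro v hv i
      have hNv : ∀ j, N.mulVecLin v (Sum.inl j) =
          ∑ a, r * (logMat d γ' j a : ℝ) * v (Sum.inl a) := fun j => by
        simp [Matrix.mulVec, dotProduct, (hmemA v).1 hv, hblock]
      rw [pow_succ, Module.End.mul_apply, ih _ (hNA v), pow_succ (logMat d γ')]
      simp only [hNv, Matrix.mul_apply, Rat.cast_sum, Rat.cast_mul, Finset.mul_sum,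
        Finset.sum_mul]
      rw [Finset.sum_comm]
      exact Finset.sum_congr rfl fun a _ => Finset.sum_congr rfl fun b _ => by ring
  have hnil : ∀ v ∈ A, (N.mulVecLin ^ p) v = 0 := fun v hv => by
    ext (i | i)
    · rw [hpow p v hv i, hp]
      simp
    · exact (hmemA _).1 (pow_apply_mem_of_map_le hAN p hv)
  refine exists_isRelMonodromyFil_of_isCompl (A := A) (n := p)
    (e := Sum.elim (fun i => -h i) fun _ => 1)
    hAN hnil ?_ (IsCompl.of_eq ?_ ?_)
  · ext (i | i)
    · simp [Matrix.mulVec, dotProduct, hcol]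
    · exact (hmemA _).1 (hNA _)
  · refine eq_bot_iff.2 ?_
    rintro v ⟨hv, hv'⟩
    obtain ⟨c, rfl⟩ := Submodule.mem_span_singleton.1 hv'
    have hc : c = 0 := by simpa using (hmemA _).1 hv
    simp [hc]
  · refine eq_top_iff.2 fun v _ => ?_
    refine Submodule.mem_sup.2 ⟨v - v (Sum.inr ()) • Sum.elim (fun i => -h i) fun _ => 1, ?_,
      _, Submodule.smul_mem _ (v (Sum.inr ())) (Submodule.mem_span_singleton_self _), ?_⟩
    · simp [hmemA]
    · simp
end

section
/- There exists a finitely generated ℤ-submodule L₀ of H'_ℚ such that, whenever the submodule L additionally satisfies L₀ ⊆ L (for any choice of the section s and the basis (e_j)), the following holds: for every ℚ-linear map N : H_ℚ → H_ℚ with N(H_ℚ) ⊆ H'_ℚ, with restriction of N to H'_ℚ equal to N', and with N(e) = N'(a) for some a ∈ H'_ℚ satisfying γ'(a) − a ∈ H', there exist x ∈ P/Q and n ∈ ℤ^m such that the ray consisting of all nonnegative real multiples of the ℝ-linear extension of N is a face of the cone σ(x,n). -/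
open Matrix

/-- The series `log γ' / (γ' - 1) = Σ_{i≥1} (-1)^{i+1} (γ'-1)^{i-1} / i`. -/
noncomputable def logQuot (d : ℕ) (γ' : (Matrix (Fin d) (Fin d) ℤ)ˣ) : Matrix (Fin d) (Fin d) ℚ :=
  ∑ i ∈ Finset.Icc 1 d,
    ((-1 : ℚ) ^ (i + 1) / (i : ℚ)) •
      ((γ' : Matrix (Fin d) (Fin d) ℤ).map (Int.cast : ℤ → ℚ) - 1) ^ (i - 1)

lemma logMat_eq_logQuot_mul (d : ℕ) (γ' : (Matrix (Fin d) (Fin d) ℤ)ˣ) :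
    logMat d γ' =
      logQuot d γ' * ((γ' : Matrix (Fin d) (Fin d) ℤ).map (Int.cast : ℤ → ℚ) - 1) := by
  rw [logMat, logQuot, Finset.sum_mul]
  refine Finset.sum_congr rfl fun i hi => ?_
  rw [smul_mul_assoc, ← pow_succ, Nat.sub_add_cancel (Finset.mem_Icc.1 hi).1]

/-- The lattice `(log γ' / (γ' - 1)) (H')`. -/
noncomputable def logQuotLattice (d : ℕ) (γ' : (Matrix (Fin d) (Fin d) ℤ)ˣ) : Submodule ℤ (Fin d → ℚ) :=
  LinearMap.range (((logQuot d γ').mulVecLin.restrictScalars ℤ) ∘ₗ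
    (LinearMap.compLeft (Algebra.linearMap ℤ ℚ) (Fin d)))

lemma logQuotLattice_fg (d : ℕ) (γ' : (Matrix (Fin d) (Fin d) ℤ)ˣ) :
    (logQuotLattice d γ').FG := by
  rw [logQuotLattice, LinearMap.range_eq_map]
  exact Module.Finite.fg_top.map _

lemma logMat_mulVec_mem_logQuotLattice {d : ℕ} {γ' : (Matrix (Fin d) (Fin d) ℤ)ˣ}
    {a : Fin d → ℚ} {v : Fin d → ℤ}
    (h : ((γ' : Matrix (Fin d) (Fin d) ℤ).map (Int.cast : ℤ → ℚ)).mulVec a - a =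
      fun i => (v i : ℚ)) :
    (logMat d γ').mulVec a ∈ logQuotLattice d γ' := by
  refine ⟨v, ?_⟩
  rw [logMat_eq_logQuot_mul, ← Matrix.mulVec_mulVec, Matrix.sub_mulVec, Matrix.one_mulVec, h]
  rfl

lemma aOrd_eq_one {d : ℕ} {γ' : (Matrix (Fin d) (Fin d) ℤ)ˣ} {L : Submodule ℤ (Fin d → ℚ)}
    {b : Psub d γ'} (hb : (b : Fin d → ℚ) ∈ L) : aOrd d γ' L ((QinP d γ').mkQ b) = 1 := by
  have h1 : 1 ∈ {a : ℕ | 0 < a ∧ ∃ v : Psub d γ', (v : Fin d → ℚ) ∈ L ∧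
      (QinP d γ').mkQ v = a • (QinP d γ').mkQ b} := ⟨one_pos, b, hb, (one_smul _ _).symm⟩
  exact le_antisymm (Nat.sInf_le h1) (Nat.sInf_mem ⟨1, h1⟩).1

/-- Rational vectors that are independent over `ℤ` stay independent over `ℝ`. -/
lemma eq_zero_of_sum_mul_ratCast_eq_zero {d m : ℕ} {E : Fin m → (Fin d → ℚ)}
    (hE : LinearIndependent ℤ E) {c : Fin m → ℝ}
    (h : ∀ i, ∑ j, c j * ((E j i : ℚ) : ℝ) = 0) : c = 0 := by
  have hQ : LinearIndependent ℚ E := (LinearIndependent.iff_fractionRing ℤ ℚ).1 hE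
  obtain ⟨g, hg⟩ := (Fintype.linearCombination ℚ E).exists_leftInverse_of_injective
    (LinearMap.ker_eq_bot.2 hQ.fintypeLinearCombination_injective)
  have key (j k : Fin m) :
      ∑ i, E j i * g (Pi.single i 1) k = (Pi.single j 1 : Fin m → ℚ) k := by
    have hj : g (E j) = Pi.single j 1 := by
      simpa using LinearMap.congr_fun hg (Pi.single j 1)
    rw [← hj]
    conv_rhs => rw [pi_eq_sum_univ' (E j)]
    simp [Finset.sum_apply]
  funext k
  have hk : ∑ j, c j * (((Pi.single j 1 : Fin m → ℚ) k : ℚ) : ℝ) = 0 := by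
    simp_rw [← key, Rat.cast_sum, Rat.cast_mul, Finset.mul_sum, ← mul_assoc]
    rw [Finset.sum_comm]
    simp_rw [← Finset.sum_mul, h, zero_mul, Finset.sum_const_zero]
  simpa [Pi.single_apply, apply_ite (Rat.cast : ℚ → ℝ)] using hk

section Cone

variable {V : Type*} [AddCommGroup V] [Module ℝ V]

lemma exists_eq_of_mem_coneOf {ι : Type*} [Fintype ι] {S : Set V} {N : V} {M : ι → V}
    (hS : ∀ f ∈ S, ∃ c : ι → ℝ, (∀ j, 0 ≤ c j) ∧ f = N + ∑ j, c j • M j)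
    {u : V} (hu : u ∈ coneOf S) :
    ∃ (t : ℝ) (c : ι → ℝ), 0 ≤ t ∧ (∀ j, 0 ≤ c j) ∧ u = t • N + ∑ j, c j • M j := by
  obtain ⟨n, f, r, hf, hr, rfl⟩ := hu
  choose c hc hfc using fun k => hS (f k) (hf k)
  refine ⟨∑ k, r k, fun j => ∑ k, r k * c k j, Finset.sum_nonneg fun k _ => hr k,
    fun j => Finset.sum_nonneg fun k _ => mul_nonneg (hr k) (hc k j), ?_⟩
  simp_rw [hfc, smul_add, Finset.sum_add_distrib, Finset.sum_smul, Finset.smul_sum, smul_smul]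
  rw [Finset.sum_comm]

lemma isConvexConeSet_rayOf (N : V) : IsConvexConeSet (rayOf N) := by
  refine ⟨⟨0, le_rfl, (zero_smul ℝ N).symm⟩, ?_, ?_⟩
  · rintro _ ⟨r, hr, rfl⟩ _ ⟨r', hr', rfl⟩
    exact ⟨r + r', add_nonneg hr hr', (add_smul r r' N).symm⟩
  · rintro r hr _ ⟨r', hr', rfl⟩
    exact ⟨r * r', mul_nonneg hr hr', smul_smul r r' N⟩

/-- The ray through a vertex `N` of a set of the form `N + Σ ℝ≥0 M_j` is a face of its cone. -/
lemma isFaceOf_rayOf_coneOf {ι : Type*} [Fintype ι] {S : Set V} {N : V} {M : ι → V}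
    (hN : N ∈ S) (hS : ∀ f ∈ S, ∃ c : ι → ℝ, (∀ j, 0 ≤ c j) ∧ f = N + ∑ j, c j • M j)
    (hM : ∀ (t : ℝ) (c : ι → ℝ), t • N + ∑ j, c j • M j = 0 → ∀ j, c j = 0 ∨ M j = 0) :
    IsFaceOf (rayOf N) (coneOf S) := by
  have left_mem {u v : V} (hu : u ∈ coneOf S) (hv : v ∈ coneOf S) (huv : u + v ∈ rayOf N) :
      u ∈ rayOf N := by
    obtain ⟨t, c, ht, hc, rfl⟩ := exists_eq_of_mem_coneOf hS hu
    obtain ⟨t', c', -, hc', rfl⟩ := exists_eq_of_mem_coneOf hS hv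
    obtain ⟨r, -, hr⟩ := huv
    have h0 : (t + t' - r) • N + ∑ j, (c j + c' j) • M j = 0 := by
      simp_rw [add_smul, Finset.sum_add_distrib]
      rw [sub_smul, ← hr, add_smul]
      abel
    refine ⟨t, ht, add_eq_left.2 (Finset.sum_eq_zero fun j _ => ?_)⟩
    rcases hM _ _ h0 j with h | h
    · rw [((add_eq_zero_iff_of_nonneg (hc j) (hc' j)).1 h).1, zero_smul]
    · rw [h, smul_zero]
  refine ⟨isConvexConeSet_rayOf N, ?_, fun u hu v hv huv =>
    ⟨left_mem hu hv huv, left_mem hv hu (add_comm u v ▸ huv)⟩⟩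
  rintro _ ⟨r, hr, rfl⟩
  exact ⟨1, fun _ => N, fun _ => r, fun _ => hN, fun _ => hr, by simp⟩

end Cone

/-- there is a finitely generated ℤ-submodule `L₀` of `H'_ℚ` such that for any
admissible `L ⊇ L₀` (and any section `s` and ℤ-basis `(e_j)` of `Q∩L`), every ℚ-linear `N`
with `N(H_ℚ) ⊆ H'_ℚ`, `N|_{H'_ℚ} = N'` and `N(e) = N'(a)` for some `a ∈ H'_ℚ` with
`γ'(a) - a ∈ H'`, has its ray as a face of some cone `σ(x,n)`. -/
theorem stmt11 (d : ℕ) (γ' : (Matrix (Fin d) (Fin d) ℤ)ˣ)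
    -- `γ' - 1` is nilpotent
    (hγ' : IsNilpotent ((γ' : Matrix (Fin d) (Fin d) ℤ) - 1)) :
    ∃ L₀ : Submodule ℤ (Fin d → ℚ), L₀.FG ∧
      ∀ L : Submodule ℤ (Fin d → ℚ), L.FG →
        (∀ v : Fin d → ℤ, (fun i => (v i : ℚ)) ∈ L) →
        (∀ v : Fin d → ℤ, (logMat d γ').mulVec (fun i => (v i : ℚ)) ∈ L) →
        -- `L` additionally contains `L₀`
        L₀ ≤ L →
        -- any choice of the section `s`
        ∀ s : PmodQ d γ' →ₗ[ℚ] Psub d γ',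
          (∀ x : PmodQ d γ', (QinP d γ').mkQ (s x) = x) →
          (∀ v : Psub d γ', (v : Fin d → ℚ) ∈ L →
            ((s ((QinP d γ').mkQ v) : Psub d γ') : Fin d → ℚ) ∈ L) →
        -- any choice of the ℤ-basis `(e_j)` of `Q ∩ L`
        ∀ (m : ℕ) (E : Fin m → (Fin d → ℚ)),
          LinearIndependent ℤ E →
          Submodule.span ℤ (Set.range E) = (Qsub d γ').restrictScalars ℤ ⊓ L →
        -- `N`: ℚ-linear with `N(H_ℚ) ⊆ H'_ℚ` and `N|_{H'_ℚ} = N'`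
        ∀ N : Matrix (Idx d) (Idx d) ℚ,
          (∀ j, N (Sum.inr ()) j = 0) →
          (∀ i j : Fin d, N (Sum.inl i) (Sum.inl j) = logMat d γ' i j) →
          -- `N(e) = N'(a)` for some `a ∈ H'_ℚ` with `γ'(a) - a ∈ H'`
          (∃ a : Fin d → ℚ,
            (fun i => N (Sum.inl i) (Sum.inr ())) = (logMat d γ').mulVec a ∧
            ∃ v : Fin d → ℤ,
              ((γ' : Matrix (Fin d) (Fin d) ℤ).map (Int.cast : ℤ → ℚ)).mulVec a - a =
                fun i => (v i : ℚ)) →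
          ∃ (x : PmodQ d γ') (n : Fin m → ℤ),
            IsFaceOf (rayOf (N.map (Rat.cast : ℚ → ℝ))) (sigmaCone d m γ' L s E x n) := by
  refine ⟨logQuotLattice d γ', logQuotLattice_fg d γ', ?_⟩
  intro L _ _ _ hL₀ s hs hsL m E hE hspan N hN0 hN' ⟨a, ha, v, hv⟩
  let b : Psub d γ' := ⟨(logMat d γ').mulVec a, a, rfl⟩
  have hbL : (b : Fin d → ℚ) ∈ L := hL₀ (logMat_mulVec_mem_logQuotLattice hv)
  set x := (QinP d γ').mkQ b
  have hdiff : (b : Fin d → ℚ) - (s x : Psub d γ') ∈ Submodule.span ℤ (Set.range E) := by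
    rw [hspan]
    refine ⟨?_, L.sub_mem hbL (hsL b hbL)⟩
    have : b - s x ∈ QinP d γ' := 
      (Submodule.Quotient.eq _).1 (hs x).symm
    exact this
  obtain ⟨n, hn⟩ := (Submodule.mem_span_range_iff_exists_fun ℤ).1 hdiff
  have hNe (i : Fin d) : (N (Sum.inl i) (Sum.inr ()) : ℝ) =
      (((s x : Psub d γ') : Fin d → ℚ) i : ℝ) + ∑ j, (n j : ℝ) * (E j i : ℝ) := by
    have h1 : N (Sum.inl i) (Sum.inr ()) = (b : Fin d → ℚ) i := congrFun ha i
    have h2 := congrFun hn i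
    simp only [Finset.sum_apply, zsmul_eq_mul, Pi.sub_apply] at h2
    rw [h1, ← sub_eq_iff_eq_add']
    exact_mod_cast h2.symm
  have haOrd : aOrd d γ' L x = 1 := aOrd_eq_one hbL
  let M : Fin m → Matrix (Idx d) (Idx d) ℝ := fun j =>
    Matrix.vecMulVec (Sum.elim (fun i => (E j i : ℝ)) 0) (Sum.elim 0 1)
  refine ⟨x, n, isFaceOf_rayOf_coneOf (M := M) ?_ ?_ ?_⟩
  · refine ⟨fun j => by simp [hN0], fun i j => by simp [hN'], fun j => n j,
      fun j => ⟨le_rfl, by linarith⟩, fun i => ?_⟩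
    simp [hNe, haOrd]
  · rintro f ⟨hf0, hf', c, hc, hfe⟩
    refine ⟨fun j => c j - n j, fun j => sub_nonneg.2 (hc j).1, ?_⟩
    ext p q
    rcases p with i | ⟨⟩ <;> rcases q with k | ⟨⟩
    · simp [M, Matrix.sum_apply, Matrix.vecMulVec_apply, hf', hN']
    · simp [M, Matrix.sum_apply, Matrix.vecMulVec_apply, hfe, hNe, haOrd, sub_mul]
    · simp [M, Matrix.sum_apply, Matrix.vecMulVec_apply, hf0, hN0]
    · simp [M, Matrix.sum_apply, Matrix.vecMulVec_apply, hf0, hN0]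
  · intro t c h j
    by_cases hlog : logMat d γ' = 0
    · right
      have hEj : E j ∈ Psub d γ' := by
        have : E j ∈ (Qsub d γ').restrictScalars ℤ ⊓ L :=
          hspan ▸ Submodule.subset_span ⟨j, rfl⟩
        exact this.1.2
      obtain ⟨w, hw⟩ := hEj
      have hEj0 : E j = 0 := by rw [← hw, hlog]; simp
      ext p q
      rcases p with i | ⟨⟩ <;> simp [M, Matrix.vecMulVec_apply, hEj0]
    · left
      obtain ⟨i, k, hik⟩ : ∃ i k, logMat d γ' i k ≠ 0 := by
        by_contra! hall
        exact hlog (Matrix.ext hall)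
      have ht : t = 0 := by
        have := congrFun (congrFun h (Sum.inl i)) (Sum.inl k)
        simpa [M, Matrix.sum_apply, Matrix.vecMulVec_apply, hN', hik] using this
      refine congrFun (eq_zero_of_sum_mul_ratCast_eq_zero hE (c := c) fun l => ?_) j
      have := congrFun (congrFun h (Sum.inl l)) (Sum.inr ())
      simpa [M, Matrix.sum_apply, Matrix.vecMulVec_apply, ht] using this
end

section
/- Assume N' ∘ N' = 0 and N' ≠ 0. Then P = Q, and for every ℚ-linear map N : H_ℚ → H_ℚ with N(H_ℚ) ⊆ H'_ℚ, with restriction of N to H'_ℚ equal to N', and with N(e) ∈ Q ∩ H', there exists n ∈ ℤ^m such that the ray consisting of all nonnegative real multiples of the ℝ-linear extension of N is a face of the cone σ(0,n). -/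
open Matrix

theorem Psub_eq_Qsub_of_sq_eq_zero {d : ℕ} {γ' : (Matrix (Fin d) (Fin d) ℤ)ˣ}
    (hsq : logMat d γ' * logMat d γ' = 0) : Psub d γ' = Qsub d γ' := by
  refine (inf_eq_right.mpr ?_).symm
  rintro _ ⟨w, rfl⟩
  simp [hsq]

theorem aOrd_zero (d : ℕ) (γ' : (Matrix (Fin d) (Fin d) ℤ)ˣ) (L : Submodule ℤ (Fin d → ℚ)) :
    aOrd d γ' L 0 = 1 := by
  have hmem : 1 ∈ {a : ℕ | 0 < a ∧ ∃ v : Psub d γ', (v : Fin d → ℚ) ∈ L ∧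
      (QinP d γ').mkQ v = a • (0 : PmodQ d γ')} :=
    ⟨one_pos, 0, by simp, by simp⟩
  exact le_antisymm (Nat.sInf_le hmem) (Nat.sInf_mem ⟨1, hmem⟩).1

theorem subset_coneOf {V : Type*} [AddCommMonoid V] [Module ℝ V] (S : Set V) : S ⊆ coneOf S :=
  fun x hx => ⟨1, fun _ => x, fun _ => 1, fun _ => hx, fun _ => zero_le_one, by simp⟩

theorem smul_mem_coneOf {V : Type*} [AddCommMonoid V] [Module ℝ V] {S : Set V} {x : V}
    (hx : x ∈ coneOf S) {c : ℝ} (hc : 0 ≤ c) : c • x ∈ coneOf S := by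
  obtain ⟨t, f, r, hf, hr, rfl⟩ := hx
  exact ⟨t, f, fun k => c * r k, hf, fun k => mul_nonneg hc (hr k), by
    simp [Finset.smul_sum, mul_smul]⟩

theorem isConvexConeSet_rayOf_s12 {V : Type*} [AddCommMonoid V] [Module ℝ V] (x : V) :
    IsConvexConeSet (rayOf x) := by
  refine ⟨⟨0, le_rfl, by simp⟩, ?_, ?_⟩
  · rintro _ ⟨a, ha, rfl⟩ _ ⟨b, hb, rfl⟩
    exact ⟨a + b, add_nonneg ha hb, (add_smul a b x).symm⟩
  · rintro c hc _ ⟨a, ha, rfl⟩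
    exact ⟨c * a, mul_nonneg hc ha, (mul_smul c a x).symm⟩

/-- Membership in `G(0,n)`, with `s(0) = 0` and `a(0) = 1` substituted. -/
theorem mem_Gset_zero_iff {d m : ℕ} {γ' : (Matrix (Fin d) (Fin d) ℤ)ˣ}
    {L : Submodule ℤ (Fin d → ℚ)} {s : PmodQ d γ' →ₗ[ℚ] Psub d γ'} {E : Fin m → (Fin d → ℚ)}
    {n : Fin m → ℤ} {M : Matrix (Idx d) (Idx d) ℝ} :
    M ∈ Gset d m γ' L s E 0 n ↔ (∀ j, M (Sum.inr ()) j = 0) ∧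
      (∀ i j : Fin d, M (Sum.inl i) (Sum.inl j) = (logMat d γ' i j : ℝ)) ∧
      ∃ c : Fin m → ℝ, (∀ j, (n j : ℝ) ≤ c j ∧ c j ≤ (n j : ℝ) + 1) ∧
        ∀ i : Fin d, M (Sum.inl i) (Sum.inr ()) = ∑ j, c j * (E j i : ℝ) := by
  simp [Gset, aOrd_zero]

/-- The entries of an element of `σ(0,n)`; only the lower bounds `n_j ≤ c_j` are retained. -/
theorem exists_entries_of_mem_sigmaCone_zero {d m : ℕ} {γ' : (Matrix (Fin d) (Fin d) ℤ)ˣ}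
    {L : Submodule ℤ (Fin d → ℚ)} {s : PmodQ d γ' →ₗ[ℚ] Psub d γ'} {E : Fin m → (Fin d → ℚ)}
    {n : Fin m → ℤ} {M : Matrix (Idx d) (Idx d) ℝ} (hM : M ∈ sigmaCone d m γ' L s E 0 n) :
    ∃ (t : ℝ) (b : Fin m → ℝ), 0 ≤ t ∧ (∀ j, t * n j ≤ b j) ∧
      (∀ j, M (Sum.inr ()) j = 0) ∧
      (∀ i j : Fin d, M (Sum.inl i) (Sum.inl j) = t * (logMat d γ' i j : ℝ)) ∧
      ∀ i : Fin d, M (Sum.inl i) (Sum.inr ()) = ∑ j, b j * (E j i : ℝ) := by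
  obtain ⟨t, f, r, hf, hr, rfl⟩ := hM
  simp only [mem_Gset_zero_iff] at hf
  choose hrow hblock c hc hcol using hf
  refine ⟨∑ k, r k, fun j => ∑ k, r k * c k j, Finset.sum_nonneg fun k _ => hr k, ?_, ?_, ?_, ?_⟩
  · intro j
    rw [Finset.sum_mul]
    exact Finset.sum_le_sum fun k _ => mul_le_mul_of_nonneg_left (hc k j).1 (hr k)
  · simp [Matrix.sum_apply, hrow]
  · simp [Matrix.sum_apply, hblock, Finset.sum_mul]
  · intro i
    simp only [Matrix.sum_apply, Matrix.smul_apply, smul_eq_mul, hcol, Finset.mul_sum,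
      Finset.sum_mul]
    rw [Finset.sum_comm]
    simp only [mul_assoc]

/-- A matrix whose last column has the vertex `n` as coordinate vector spans an extremal ray
of `σ(0,n)`. -/
theorem isFaceOf_rayOf_sigmaCone_zero {d m : ℕ} {γ' : (Matrix (Fin d) (Fin d) ℤ)ˣ}
    (L : Submodule ℤ (Fin d → ℚ)) (s : PmodQ d γ' →ₗ[ℚ] Psub d γ') {E : Fin m → (Fin d → ℚ)}
    (hE : LinearIndependent ℤ E) (hne : logMat d γ' ≠ 0) {n : Fin m → ℤ}
    {M : Matrix (Idx d) (Idx d) ℝ} (hrow : ∀ j, M (Sum.inr ()) j = 0)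
    (hblock : ∀ i j : Fin d, M (Sum.inl i) (Sum.inl j) = (logMat d γ' i j : ℝ))
    (hcol : ∀ i : Fin d, M (Sum.inl i) (Sum.inr ()) = ∑ j, (n j : ℝ) * (E j i : ℝ)) :
    IsFaceOf (rayOf M) (sigmaCone d m γ' L s E 0 n) := by
  have hER : LinearIndependent ℝ fun j => algebraMap ℚ ℝ ∘ E j :=
    linearIndependent_algebraMap_comp_iff.mpr ((LinearIndependent.iff_fractionRing ℤ ℚ).mp hE)
  obtain ⟨i₀, j₀, hij⟩ : ∃ i j, logMat d γ' i j ≠ 0 := by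
    by_contra! h
    exact hne (Matrix.ext h)
  have hMG : M ∈ Gset d m γ' L s E 0 n :=
    mem_Gset_zero_iff.mpr ⟨hrow, hblock, fun j => n j, fun j => ⟨le_rfl, by simp⟩, hcol⟩
  refine ⟨isConvexConeSet_rayOf_s12 M, ?_, ?_⟩
  · rintro _ ⟨r, hr, rfl⟩
    exact smul_mem_coneOf (subset_coneOf _ hMG) hr
  rintro u hu v hv ⟨r, -, huv⟩
  obtain ⟨t, b, ht, hb, urow, ublock, ucol⟩ := exists_entries_of_mem_sigmaCone_zero hu
  obtain ⟨t', b', ht', hb', vrow, vblock, vcol⟩ := exists_entries_of_mem_sigmaCone_zero hv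
  have htr : t + t' = r := by
    have h := congrFun (congrFun huv (Sum.inl i₀)) (Sum.inl j₀)
    simp only [Matrix.add_apply, Matrix.smul_apply, smul_eq_mul, ublock, vblock, hblock,
      ← add_mul] at h
    exact mul_right_cancel₀ (Rat.cast_ne_zero.mpr hij) h
  have hbr : ∀ j, b j + b' j - r * n j = 0 := by
    refine Fintype.linearIndependent_iff.mp hER _ (funext fun i => ?_)
    have h := congrFun (congrFun huv (Sum.inl i)) (Sum.inr ())
    simp only [Matrix.add_apply, Matrix.smul_apply, smul_eq_mul, ucol, vcol, hcol] at h
    simp [sub_mul, add_mul, Finset.sum_add_distrib, h, Finset.mul_sum, mul_assoc]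
  have hbt : ∀ j, b j = t * n j ∧ b' j = t' * n j := by
    intro j
    have h₁ := hb j
    have h₂ := hb' j
    have h₃ := hbr j
    rw [← htr, add_mul] at h₃
    constructor <;> linarith
  constructor
  · refine ⟨t, ht, Matrix.ext ?_⟩
    rintro (i | _) (j | _) <;>
      simp [urow, ublock, ucol, hrow, hblock, hcol, hbt, Finset.mul_sum, mul_assoc]
  · refine ⟨t', ht', Matrix.ext ?_⟩
    rintro (i | _) (j | _) <;>
      simp [vrow, vblock, vcol, hrow, hblock, hcol, hbt, Finset.mul_sum, mul_assoc]

/-- if `N' ∘ N' = 0` and `N' ≠ 0`, then `P = Q`, and every ℚ-linear `N` with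
`N(H_ℚ) ⊆ H'_ℚ`, `N|_{H'_ℚ} = N'` and `N(e) ∈ Q ∩ H'` has its ray as a face of some cone
`σ(0,n)`. -/
theorem stmt12
    (d m : ℕ) (γ' : (Matrix (Fin d) (Fin d) ℤ)ˣ)
    -- `γ' - 1` is nilpotent
    (hγ' : IsNilpotent ((γ' : Matrix (Fin d) (Fin d) ℤ) - 1))
    -- `L`: a finitely generated ℤ-submodule of `H'_ℚ` containing `H' + N'(H')`
    (L : Submodule ℤ (Fin d → ℚ)) (hLfg : L.FG)
    (hLH : ∀ v : Fin d → ℤ, (fun i => (v i : ℚ)) ∈ L)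
    (hLN : ∀ v : Fin d → ℤ, (logMat d γ').mulVec (fun i => (v i : ℚ)) ∈ L)
    -- `s`: the ℚ-linear map `P/Q → P` induced by a ℤ-linear section of
    -- `P∩L → (P∩L)/(Q∩L)`; equivalently, a ℚ-linear section of `P → P/Q`
    -- mapping classes of elements of `P∩L` into `L`
    (s : PmodQ d γ' →ₗ[ℚ] Psub d γ')
    (hs : ∀ x : PmodQ d γ', (QinP d γ').mkQ (s x) = x)
    (hsL : ∀ v : Psub d γ', (v : Fin d → ℚ) ∈ L →
      ((s ((QinP d γ').mkQ v) : Psub d γ') : Fin d → ℚ) ∈ L)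
    -- `(e_j)`: a ℤ-basis of `Q ∩ L`
    (E : Fin m → (Fin d → ℚ))
    (hEind : LinearIndependent ℤ E)
    (hEspan : Submodule.span ℤ (Set.range E) = (Qsub d γ').restrictScalars ℤ ⊓ L)
    -- `N' ∘ N' = 0` and `N' ≠ 0`
    (hsq : logMat d γ' * logMat d γ' = 0) (hne : logMat d γ' ≠ 0) :
    Psub d γ' = Qsub d γ' ∧
    ∀ N : Matrix (Idx d) (Idx d) ℚ,
      -- `N(H_ℚ) ⊆ H'_ℚ`
      (∀ j, N (Sum.inr ()) j = 0) →
      -- the restriction of `N` to `H'_ℚ` is `N'`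
      (∀ i j : Fin d, N (Sum.inl i) (Sum.inl j) = logMat d γ' i j) →
      -- `N(e) ∈ Q`
      ((fun i => N (Sum.inl i) (Sum.inr ())) ∈ Qsub d γ') →
      -- `N(e) ∈ H'`
      (∃ v : Fin d → ℤ, ∀ i, N (Sum.inl i) (Sum.inr ()) = (v i : ℚ)) →
      ∃ n : Fin m → ℤ,
        IsFaceOf (rayOf (N.map (Rat.cast : ℚ → ℝ)))
          (sigmaCone d m γ' L s E (0 : PmodQ d γ') n) := by
  refine ⟨Psub_eq_Qsub_of_sq_eq_zero hsq, fun N hrow hblock hQ ⟨v, hv⟩ => ?_⟩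
  have hmem : (fun i => N (Sum.inl i) (Sum.inr ())) ∈ Submodule.span ℤ (Set.range E) := by
    rw [hEspan]
    refine ⟨hQ, ?_⟩
    rw [funext hv]
    exact hLH v
  obtain ⟨n, hn⟩ := (Submodule.mem_span_range_iff_exists_fun ℤ).mp hmem
  refine ⟨n, isFaceOf_rayOf_sigmaCone_zero L s hEind hne ?_ ?_ fun i => ?_⟩
  · simp [hrow]
  · simp [hblock]
  · have h := congrFun hn i
    simp [← h]
end
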